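/- arXiv:1806.02524 — 3 statements merged into one kernel-verified Lean document; each statement's English description precedes it below -/
import Mathlib

section
/- Let 𝒦 be a finitely pre-complete, locally small category. Then the free colimit completion 𝒫𝒦 is a pretopos; moreover 𝒫𝒦 is infinitary extensive, every monomorphism in 𝒫𝒦 is regular, and every epimorphism in 𝒫𝒦 is regular. -/
/- Common definitions for formalizing "How nice are free completions of categories?"
   by Adámek and Rosický. -/

open CategoryTheory CategoryTheory.Limits

universe w w₁ w₂ v₁ u₁

namespace FreeCompletions

/-- A presheaf is *small* if it is a colimit of representables over a small
(`Type w`-indexed) diagram. -/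
def IsSmallPresheaf {C : Type u₁} [Category.{v₁} C] (F : Cᵒᵖ ⥤ Type v₁) : Prop :=
  ∃ (J : Type w) (_ : SmallCategory J) (D : J ⥤ C) (c : Cocone (D ⋙ yoneda)),
    Nonempty (IsColimit c) ∧ Nonempty (c.pt ≅ F)

/-- A presheaf is a (small) coproduct of representables. -/
def IsCoproductOfRepresentables {C : Type u₁} [Category.{v₁} C] (F : Cᵒᵖ ⥤ Type v₁) : Prop :=
  ∃ (I : Type v₁) (A : I → C), Nonempty (F ≅ ∐ fun i => yoneda.obj (A i))

/-- The free coproduct completion `Σ𝒦`, realized as the full subcategory of presheaves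
consisting of coproducts of representables. -/
abbrev SigmaCompletion (K : Type u₁) [Category.{v₁} K] :=
  ObjectProperty.FullSubcategory (IsCoproductOfRepresentables (C := K))

/-- The free colimit completion `𝒫𝒦`, the full subcategory of presheaves
consisting of the small presheaves. -/
abbrev PCompletion (K : Type u₁) [Category.{v₁} K] :=
  ObjectProperty.FullSubcategory (IsSmallPresheaf.{v₁} (C := K))

/-- The object of `Σ𝒦` given by a small family of objects of `𝒦`. -/
noncomputable def famObj {K : Type u₁} [Category.{v₁} K] {I : Type v₁} (B : I → K) :
    SigmaCompletion K :=
  ⟨∐ fun i => yoneda.obj (B i), ⟨I, B, ⟨Iso.refl _⟩⟩⟩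

theorem isSmallPresheaf_coprod {K : Type u₁} [Category.{v₁} K] {I : Type v₁} (B : I → K) :
    IsSmallPresheaf.{v₁} (∐ fun i => yoneda.obj (B i)) := by
  let G := Discrete.functor (fun i => yoneda.obj (B i))
  let e : Discrete.functor B ⋙ yoneda ≅ G := Discrete.natIso (fun i => Iso.refl _)
  exact ⟨Discrete I, inferInstance, Discrete.functor B,
    (Cocone.precompose e.hom).obj (colimit.cocone G),
    ⟨(IsColimit.precomposeHomEquiv e (colimit.cocone G)).symm (colimit.isColimit G)⟩,
    ⟨Iso.refl _⟩⟩

/-- The object of `𝒫𝒦` given by a small coproduct of representables. -/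
noncomputable def pcoprodObj {K : Type u₁} [Category.{v₁} K] {I : Type v₁} (B : I → K) :
    PCompletion K :=
  ⟨∐ fun i => yoneda.obj (B i), isSmallPresheaf_coprod B⟩

/-- A diagram `D` has a *multi-limit*: a set of cones through which every cone
factorizes uniquely (unique member and unique factorization). -/
def HasMultiLimit {J : Type w₁} [Category.{w₂} J] {C : Type u₁} [Category.{v₁} C]
    (D : J ⥤ C) : Prop :=
  ∃ (T : Type w) (c : T → Cone D), ∀ s : Cone D,
    ∃ p : Σ t : T, s ⟶ c t, ∀ q : Σ t : T, s ⟶ c t, q = p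

/-- `𝒦` is finitely multi-complete: every finite diagram has a multi-limit. -/
def FinitelyMultiComplete (C : Type u₁) [Category.{v₁} C] : Prop :=
  ∀ (J : Type) [SmallCategory J] [FinCategory J] (D : J ⥤ C), HasMultiLimit.{v₁} D

/-- A family `A : I → C` has a *multi-product*: a set of cones through which every cone
factorizes uniquely (unique member and unique factorization). -/
def HasMultiProduct {C : Type u₁} [Category.{v₁} C] {I : Type w₁} (A : I → C) : Prop :=
  ∃ (T : Type w) (P : T → C) (π : ∀ t i, P t ⟶ A i),
    ∀ (X : C) (f : ∀ i, X ⟶ A i),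
      ∃ p : Σ t : T, X ⟶ P t, (∀ i, p.2 ≫ π p.1 i = f i) ∧
        ∀ q : Σ t : T, X ⟶ P t, (∀ i, q.2 ≫ π q.1 i = f i) → q = p

/-- `C` has multi-products of all set-indexed families. -/
def HasMultiProducts (C : Type u₁) [Category.{v₁} C] : Prop :=
  ∀ (I : Type v₁) (A : I → C), HasMultiProduct.{v₁} A

/-- A diagram `D` has a *pre-limit*: a set of cones through which every cone
factorizes (not necessarily uniquely). -/
def HasPreLimit {J : Type w₁} [Category.{w₂} J] {C : Type u₁} [Category.{v₁} C]
    (D : J ⥤ C) : Prop :=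
  ∃ (T : Type w) (c : T → Cone D), ∀ s : Cone D, ∃ t : T, Nonempty (s ⟶ c t)

/-- `C` is pre-complete: every small diagram has a pre-limit. -/
def PreComplete (C : Type u₁) [Category.{v₁} C] : Prop :=
  ∀ (J : Type v₁) [SmallCategory J] (D : J ⥤ C), HasPreLimit.{v₁} D

/-- `C` is finitely pre-complete: every finite diagram has a pre-limit. -/
def FinitelyPreComplete (C : Type u₁) [Category.{v₁} C] : Prop :=
  ∀ (J : Type) [SmallCategory J] [FinCategory J] (D : J ⥤ C), HasPreLimit.{v₁} D

/-- A family `A : I → C` has a *pre-product*: a set of cones through which every cone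
factorizes (not necessarily uniquely). -/
def HasPreProduct {C : Type u₁} [Category.{v₁} C] {I : Type w₁} (A : I → C) : Prop :=
  ∃ (T : Type w) (P : T → C) (π : ∀ t i, P t ⟶ A i),
    ∀ (X : C) (f : ∀ i, X ⟶ A i), ∃ (t : T) (h : X ⟶ P t), ∀ i, h ≫ π t i = f i

/-- `C` (with finite products) is cartesian multi-closed: each functor `A × -` is a
left multi-adjoint. -/
def CartesianMultiClosedOf (C : Type u₁) [Category.{v₁} C] [HasFiniteProducts C] : Prop :=
  ∀ A B : C, ∃ (I : Type v₁) (E : I → C) (ev : ∀ i, A ⨯ E i ⟶ B),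
    ∀ (X : C) (c : A ⨯ X ⟶ B),
      ∃ p : Σ i : I, X ⟶ E i, (prod.map (𝟙 A) p.2 ≫ ev p.1 = c) ∧
        ∀ q : Σ i : I, X ⟶ E i, prod.map (𝟙 A) q.2 ≫ ev q.1 = c → q = p

/-- `C` is cartesian multi-closed: it has finite products and each functor `A × -` is a
left multi-adjoint. -/
def CartesianMultiClosed (C : Type u₁) [Category.{v₁} C] : Prop :=
  ∃ h : HasFiniteProducts C, @CartesianMultiClosedOf C _ h

/-- `C` is cartesian closed (as a property: it has finite products and each `A × -`
is a left adjoint). -/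
def CartesianClosedP (C : Type u₁) [Category.{v₁} C] : Prop :=
  ∃ h : CartesianMonoidalCategory C, Nonempty (@MonoidalClosed C _ h.toMonoidalCategory)

/-- `C` is locally cartesian closed: every slice category is cartesian closed. -/
def LocallyCartesianClosedP (C : Type u₁) [Category.{v₁} C] : Prop :=
  ∀ A : C, CartesianClosedP (Over A)

/-- `C` is locally cartesian multi-closed: every slice category is cartesian multi-closed. -/
def LocallyCartesianMultiClosed (C : Type u₁) [Category.{v₁} C] : Prop :=
  ∀ A : C, CartesianMultiClosed (Over A)

/-- `C` (with finite products) is cartesian pre-closed: each functor `C(A × -, B)`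
is a small presheaf. -/
def CartesianPreClosedOf (C : Type u₁) [Category.{v₁} C] [HasFiniteProducts C] : Prop :=
  ∀ A B : C, IsSmallPresheaf.{w} ((prod.functor.obj A).op ⋙ yoneda.obj B)

/-- `C` is cartesian pre-closed: it has finite products and each functor `C(A × -, B)`
is a small presheaf. -/
def CartesianPreClosed (C : Type u₁) [Category.{v₁} C] : Prop :=
  ∃ h : HasFiniteProducts C, @CartesianPreClosedOf.{w} C _ h

/-- `C` (with binary products) has weak simple products. -/
def HasWeakSimpleProductsOf (C : Type u₁) [Category.{v₁} C] [HasBinaryProducts C] : Prop :=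
  ∀ (A X B : C) (b : B ⟶ A ⨯ X),
    ∃ (P : C) (ε : A ⨯ P ⟶ B) (w : P ⟶ X),
      ε ≫ b = prod.map (𝟙 A) w ∧
      ∀ (P' : C) (ε' : A ⨯ P' ⟶ B) (w' : P' ⟶ X), ε' ≫ b = prod.map (𝟙 A) w' →
        ∃ f : P' ⟶ P, ε' = prod.map (𝟙 A) f ≫ ε ∧ w' = f ≫ w

/-- `C` has binary products and weak simple products. -/
def HasWeakSimpleProducts (C : Type u₁) [Category.{v₁} C] : Prop :=
  ∃ h : HasBinaryProducts C, @HasWeakSimpleProductsOf C _ h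

/-- `C` has a subobject classifier: a mono `ε : 1 ⟶ Ω` from the terminal object such that
every monomorphism is a pullback of `ε` along a unique morphism. -/
def HasSubobjectClassifierP (C : Type u₁) [Category.{v₁} C] : Prop :=
  ∃ (T Ω : C) (hT : IsTerminal T) (ε : T ⟶ Ω), Mono ε ∧
    ∀ ⦃U X : C⦄ (m : U ⟶ X), Mono m → ∃! χ : X ⟶ Ω, IsPullback (hT.from U) m ε χ

/-- `C` is an elementary topos: finitely complete, cartesian closed,
with a subobject classifier. -/
def IsElementaryTopos (C : Type u₁) [Category.{v₁} C] : Prop :=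
  HasFiniteLimits C ∧ CartesianClosedP C ∧ HasSubobjectClassifierP C

/-- `C` is a multi-topos: finitely complete, cartesian multi-closed,
with a subobject classifier. -/
def IsMultiTopos (C : Type u₁) [Category.{v₁} C] : Prop :=
  HasFiniteLimits C ∧ CartesianMultiClosed C ∧ HasSubobjectClassifierP C

/-- A coproduct cocone is *universal*: it is stable under pullback. -/
def CofanUniversal {C : Type u₁} [Category.{v₁} C] {I : Type w₁} {X : I → C}
    (c : Cofan X) : Prop :=
  ∀ {W : C} (h : W ⟶ c.pt) (Y : I → C) (p : ∀ i, Y i ⟶ W) (q : ∀ i, Y i ⟶ X i),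
    (∀ i, IsPullback (p i) (q i) h (c.inj i)) → Nonempty (IsColimit (Cofan.mk W p))

/-- A coproduct cocone is *disjoint*: injections are monic with initial pairwise
intersections. -/
def CofanDisjoint {C : Type u₁} [Category.{v₁} C] {I : Type w₁} {X : I → C}
    (c : Cofan X) : Prop :=
  (∀ i, Mono (c.inj i)) ∧
    ∀ i j, i ≠ j → ∀ {Z : C} (u : Z ⟶ X i) (v : Z ⟶ X j),
      IsPullback u v (c.inj i) (c.inj j) → Nonempty (IsInitial Z)

/-- `C` is extensive: finitely complete, with finite coproducts which are
universal and disjoint. -/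
def IsExtensive (C : Type u₁) [Category.{v₁} C] : Prop :=
  HasFiniteLimits C ∧ HasFiniteCoproducts C ∧
    ∀ (I : Type) [Finite I] (X : I → C) (c : Cofan X),
      Nonempty (IsColimit c) → CofanUniversal c ∧ CofanDisjoint c

/-- `C` is infinitary extensive: finitely complete, with small (`Type w`-indexed)
coproducts which are universal and disjoint. -/
def IsInfinitaryExtensive (C : Type u₁) [Category.{v₁} C] : Prop :=
  HasFiniteLimits C ∧ HasCoproducts.{w} C ∧
    ∀ (I : Type w) (X : I → C) (c : Cofan X),
      Nonempty (IsColimit c) → CofanUniversal c ∧ CofanDisjoint c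

/-- A parallel pair `r₁ r₂ : R ⟶ X` is an (internal) equivalence relation. -/
structure IsEquivalenceRelationPair {C : Type u₁} [Category.{v₁} C] {R X : C}
    (r₁ r₂ : R ⟶ X) : Prop where
  jointlyMono : ∀ {Z : C} (a b : Z ⟶ R), a ≫ r₁ = b ≫ r₁ → a ≫ r₂ = b ≫ r₂ → a = b
  refl : ∀ {Z : C} (f : Z ⟶ X), ∃ d : Z ⟶ R, d ≫ r₁ = f ∧ d ≫ r₂ = f
  symm : ∃ s : R ⟶ R, s ≫ r₁ = r₂ ∧ s ≫ r₂ = r₁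
  trans : ∀ {Z : C} (a b : Z ⟶ R), a ≫ r₂ = b ≫ r₁ →
    ∃ t : Z ⟶ R, t ≫ r₁ = a ≫ r₁ ∧ t ≫ r₂ = b ≫ r₂

/-- `C` is a regular category: finitely complete, with (regular epi, mono)
factorizations, and regular epimorphisms are stable under pullback. -/
def IsRegularCat (C : Type u₁) [Category.{v₁} C] : Prop :=
  HasFiniteLimits C ∧
    (∀ {X Y : C} (f : X ⟶ Y), ∃ (Z : C) (e : X ⟶ Z) (m : Z ⟶ Y),
      e ≫ m = f ∧ Nonempty (RegularEpi e) ∧ Mono m) ∧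
    (∀ {P X Y Z : C} (fst : P ⟶ X) (snd : P ⟶ Y) (f : X ⟶ Z) (g : Y ⟶ Z),
      IsPullback fst snd f g → Nonempty (RegularEpi g) → Nonempty (RegularEpi fst))

/-- `C` is an exact (Barr-exact) category: regular with effective equivalence relations. -/
def IsExactCat (C : Type u₁) [Category.{v₁} C] : Prop :=
  IsRegularCat C ∧
    ∀ {R X : C} (r₁ r₂ : R ⟶ X), IsEquivalenceRelationPair r₁ r₂ →
      ∃ (Y : C) (f : X ⟶ Y), IsPullback r₁ r₂ f f

/-- A pretopos is an exact and extensive category. -/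
def IsPretopos (C : Type u₁) [Category.{v₁} C] : Prop :=
  IsExactCat C ∧ IsExtensive C

/-- `C` is additive: preadditive with finite biproducts. -/
def IsAdditive (C : Type u₁) [Category.{v₁} C] : Prop :=
  ∃ p : Preadditive C, letI := p; HasFiniteBiproducts C

/-- `C` is wellpowered: every object has only a set of subobjects. -/
def Wellpowered (C : Type u₁) [Category.{v₁} C] : Prop :=
  ∀ X : C, Small.{w} (Subobject X)

/-- `C` is cowellpowered: every object has only a set of quotient objects. -/
def Cowellpowered (C : Type u₁) [Category.{v₁} C] : Prop :=
  ∀ X : C, Small.{w} (Subobject (Opposite.op X))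

/-- `C` has a clique-like class of objects, indexed by all ordinals. -/
def HasCliqueLikeClass (C : Type u₁) [Category.{v₁} C] : Prop :=
  ∃ (A : Ordinal.{v₁} → C) (R : MorphismProperty C),
    (∀ {X Y Z : C} (v : X ⟶ Y) (u : Y ⟶ Z), R (v ≫ u) → R u) ∧
    (∀ k, ∃ f g : A 0 ⟶ A k, f ≠ g ∧ R f ∧ R g) ∧
    ((∀ i k : Ordinal.{v₁}, 0 < i → i < k → ∀ f : A k ⟶ A i, ¬ R f) ∨
     (∀ k i : Ordinal.{v₁}, 0 < k → k < i → ∀ f : A k ⟶ A i, ¬ R f))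

/-- A presheaf is petty: a quotient of a small coproduct of representables. -/
def IsPetty {C : Type u₁} [Category.{v₁} C] (F : Cᵒᵖ ⥤ Type v₁) : Prop :=
  ∃ (I : Type v₁) (A : I → C) (e : (∐ fun i => yoneda.obj (A i)) ⟶ F), Epi e

/-- A presheaf is lucid: petty, and equalizers of pairs of morphisms from petty
presheaves into it are petty. -/
noncomputable def IsLucid {C : Type u₁} [Category.{v₁} C] (F : Cᵒᵖ ⥤ Type v₁) : Prop :=
  IsPetty F ∧ ∀ (P : Cᵒᵖ ⥤ Type v₁), IsPetty P → ∀ u₁ u₂ : P ⟶ F, IsPetty (equalizer u₁ u₂)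

universe v u

section Part1

open Opposite

variable {K : Type u} [Category.{v} K]

/-- Restriction of a section of a presheaf. -/
def res (F : Kᵒᵖ ⥤ Type v) {U V : K} (f : U ⟶ V) (x : F.obj (op V)) : F.obj (op U) :=
  F.map f.op x

theorem res_id (F : Kᵒᵖ ⥤ Type v) {U : K} (x : F.obj (op U)) : res F (𝟙 U) x = x := by
  simp [res]

theorem res_res (F : Kᵒᵖ ⥤ Type v) {U V W : K} (f : U ⟶ V) (g : V ⟶ W) (x : F.obj (op W)) :
    res F f (res F g x) = res F (f ≫ g) x := by
  simp [res]

/-- Action of a natural transformation on sections. -/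
def apn {F G : Kᵒᵖ ⥤ Type v} (α : F ⟶ G) {U : K} (x : F.obj (op U)) : G.obj (op U) :=
  α.app (op U) x

theorem apn_res {F G : Kᵒᵖ ⥤ Type v} (α : F ⟶ G) {U V : K} (f : U ⟶ V) (x : F.obj (op V)) :
    apn α (res F f x) = res G f (apn α x) := by
  simp [apn, res]

theorem apn_comp {F G H : Kᵒᵖ ⥤ Type v} (α : F ⟶ G) (β : G ⟶ H) {U : K} (x : F.obj (op U)) :
    apn (α ≫ β) x = apn β (apn α x) := by
  simp [apn]

theorem apn_ext {F G : Kᵒᵖ ⥤ Type v} {α β : F ⟶ G}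
    (h : ∀ (U : K) (x : F.obj (op U)), apn α x = apn β x) : α = β := by
  ext U x
  exact h U.unop x

/-- Build a presheaf from its restriction maps. -/
def mkPsh (S : K → Type v) (r : ∀ {U V : K}, (U ⟶ V) → S V → S U)
    (r_id : ∀ U (x : S U), r (𝟙 U) x = x)
    (r_comp : ∀ {U V W : K} (f : U ⟶ V) (g : V ⟶ W) (x : S W), r f (r g x) = r (f ≫ g) x) :
    Kᵒᵖ ⥤ Type v where
  obj U := S U.unop
  map f := ↾(r f.unop)
  map_id U := by ext x; exact r_id _ x
  map_comp f g := by ext x; exact (r_comp _ _ x).symm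

/-- Build a natural transformation from its action on sections. -/
def mkNat {F G : Kᵒᵖ ⥤ Type v} (φ : ∀ U : K, F.obj (op U) → G.obj (op U))
    (h : ∀ {U V : K} (f : U ⟶ V) (x : F.obj (op V)), φ U (res F f x) = res G f (φ V x)) :
    F ⟶ G where
  app U := ↾(φ U.unop)
  naturality U V f := by ext x; exact h f.unop x

theorem apn_mkNat {F G : Kᵒᵖ ⥤ Type v} (φ : ∀ U : K, F.obj (op U) → G.obj (op U))
    (h : ∀ {U V : K} (f : U ⟶ V) (x : F.obj (op V)), φ U (res F f x) = res G f (φ V x))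
    {U : K} (x : F.obj (op U)) : apn (mkNat φ h) x = φ U x := rfl

/-- A span relation generated by a small family of spans. -/
def PSpan {A B : K} (S : ∀ U : K, (U ⟶ A) → (U ⟶ B) → Prop) : Prop :=
  ∃ (T : Type v) (R : T → K) (a : ∀ t, R t ⟶ A) (b : ∀ t, R t ⟶ B),
    ∀ U f g, S U f g ↔ ∃ (t : T) (k : U ⟶ R t), k ≫ a t = f ∧ k ≫ b t = g

theorem PSpan.congr {A B : K} {S S' : ∀ U : K, (U ⟶ A) → (U ⟶ B) → Prop}
    (hS : PSpan S) (h : ∀ U f g, S' U f g ↔ S U f g) : PSpan S' := by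
  obtain ⟨T, R, a, b, hh⟩ := hS
  exact ⟨T, R, a, b, fun U f g => (h U f g).trans (hh U f g)⟩

theorem PSpan.empty {A B : K} : PSpan (fun U (_ : U ⟶ A) (_ : U ⟶ B) => False) :=
  ⟨PEmpty, fun t => t.elim, fun t => t.elim, fun t => t.elim, fun U f g => by simp⟩

theorem PSpan.graph {A B : K} (u : A ⟶ B) : PSpan (fun U (f : U ⟶ A) (g : U ⟶ B) => f ≫ u = g) :=
  ⟨PUnit, fun _ => A, fun _ => 𝟙 A, fun _ => u, fun U f g =>
    ⟨fun h => ⟨⟨⟩, f, by simp, h⟩, by rintro ⟨-, k, rfl, rfl⟩; simp⟩⟩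

theorem PSpan.symm {A B : K} {S : ∀ U : K, (U ⟶ A) → (U ⟶ B) → Prop}
    (hS : PSpan S) : PSpan (fun U (f : U ⟶ B) (g : U ⟶ A) => S U g f) := by
  obtain ⟨T, R, a, b, hh⟩ := hS
  refine ⟨T, R, b, a, fun U f g => (hh U g f).trans ?_⟩
  simp only [and_comm]

theorem PSpan.iUnion {A B : K} {T : Type v} {S : T → ∀ U : K, (U ⟶ A) → (U ⟶ B) → Prop}
    (hS : ∀ t, PSpan (S t)) : PSpan (fun U f g => ∃ t, S t U f g) := by
  choose T' R a b hh using hS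
  refine ⟨Σ t, T' t, fun p => R p.1 p.2, fun p => a p.1 p.2, fun p => b p.1 p.2, fun U f g => ?_⟩
  constructor
  · rintro ⟨t, ht⟩
    obtain ⟨s, k, h1, h2⟩ := (hh t U f g).1 ht
    exact ⟨⟨t, s⟩, k, h1, h2⟩
  · rintro ⟨⟨t, s⟩, k, h1, h2⟩
    exact ⟨t, (hh t U f g).2 ⟨s, k, h1, h2⟩⟩

theorem prePullback (h : FinitelyPreComplete K) {A B C : K} (u : A ⟶ C) (w : B ⟶ C) :
    PSpan (fun U (f : U ⟶ A) (g : U ⟶ B) => f ≫ u = g ≫ w) := by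
  obtain ⟨T, c, hc⟩ := h WalkingCospan (cospan u w)
  refine ⟨T, fun t => (c t).pt, fun t => PullbackCone.fst (c t), fun t => PullbackCone.snd (c t),
    fun U f g => ⟨fun e => ?_, ?_⟩⟩
  · obtain ⟨t, ⟨k⟩⟩ := hc (PullbackCone.mk f g e)
    exact ⟨t, k.hom, k.w WalkingCospan.left, k.w WalkingCospan.right⟩
  · rintro ⟨t, k, rfl, rfl⟩
    simp [PullbackCone.condition]

theorem preProd (h : FinitelyPreComplete K) (A B : K) :
    PSpan (fun U (_ : U ⟶ A) (_ : U ⟶ B) => True) := by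
  obtain ⟨T, c, hc⟩ := h (Discrete WalkingPair) (pair A B)
  refine ⟨T, fun t => (c t).pt, fun t => BinaryFan.fst (c t), fun t => BinaryFan.snd (c t),
    fun U f g => ⟨fun e => ?_, fun _ => trivial⟩⟩
  obtain ⟨t, ⟨k⟩⟩ := hc (BinaryFan.mk f g)
  exact ⟨t, k.hom, k.w ⟨WalkingPair.left⟩, k.w ⟨WalkingPair.right⟩⟩

theorem preEq (h : FinitelyPreComplete K) {A B : K} (u w : A ⟶ B) :
    ∃ (T : Type v) (R : T → K) (a : ∀ t, R t ⟶ A),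
      ∀ U (f : U ⟶ A), f ≫ u = f ≫ w ↔ ∃ (t : T) (k : U ⟶ R t), k ≫ a t = f := by
  obtain ⟨T, c, hc⟩ := h WalkingParallelPair (parallelPair u w)
  refine ⟨T, fun t => (c t).pt, fun t => Fork.ι (c t), fun U f => ⟨fun e => ?_, ?_⟩⟩
  · obtain ⟨t, ⟨k⟩⟩ := hc (Fork.ofι f e)
    exact ⟨t, k.hom, k.w WalkingParallelPair.zero⟩
  · rintro ⟨t, k, rfl⟩
    have := Fork.condition (c t)
    simp only [Category.assoc]
    exact congrArg (k ≫ ·) this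

theorem preTerm (h : FinitelyPreComplete K) :
    ∃ (T : Type v) (R : T → K), ∀ U : K, ∃ t, Nonempty (U ⟶ R t) := by
  obtain ⟨T, c, hc⟩ := h (Discrete PEmpty) (Functor.empty K)
  refine ⟨T, fun t => (c t).pt, fun U => ?_⟩
  obtain ⟨t, ⟨k⟩⟩ := hc (asEmptyCone U)
  exact ⟨t, ⟨k.hom⟩⟩

theorem PSpan.comp (h : FinitelyPreComplete K) {A B C : K}
    {S : ∀ U : K, (U ⟶ A) → (U ⟶ B) → Prop} {S' : ∀ U : K, (U ⟶ B) → (U ⟶ C) → Prop}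
    (hS : PSpan S) (hS' : PSpan S') :
    PSpan (fun U f g => ∃ m, S U f m ∧ S' U m g) := by
  obtain ⟨T, R, a, b, hh⟩ := hS
  obtain ⟨T', R', a', b', hh'⟩ := hS'
  have key : ∀ p : T × T', PSpan (fun U (f : U ⟶ A) (g : U ⟶ C) =>
      ∃ (k : U ⟶ R p.1) (k' : U ⟶ R' p.2), k ≫ b p.1 = k' ≫ a' p.2 ∧
        k ≫ a p.1 = f ∧ k' ≫ b' p.2 = g) := by
    intro p
    obtain ⟨T₂, R₂, a₂, b₂, hh₂⟩ := prePullback h (b p.1) (a' p.2)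
    refine ⟨T₂, R₂, fun t => a₂ t ≫ a p.1, fun t => b₂ t ≫ b' p.2, fun U f g => ⟨?_, ?_⟩⟩
    · rintro ⟨k, k', e, rfl, rfl⟩
      obtain ⟨t, l, rfl, rfl⟩ := (hh₂ U k k').1 e
      exact ⟨t, l, by simp, by simp⟩
    · rintro ⟨t, l, rfl, rfl⟩
      exact ⟨l ≫ a₂ t, l ≫ b₂ t, (hh₂ _ _ _).2 ⟨t, l, rfl, rfl⟩, by simp, by simp⟩
  refine (PSpan.iUnion key).congr fun U f g => ⟨?_, ?_⟩
  · rintro ⟨m, h1, h2⟩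
    obtain ⟨t, k, rfl, rfl⟩ := (hh _ _ _).1 h1
    obtain ⟨t', k', e, rfl⟩ := (hh' _ _ _).1 h2
    exact ⟨⟨t, t'⟩, k, k', e.symm, rfl, rfl⟩
  · rintro ⟨⟨t, t'⟩, k, k', e, rfl, rfl⟩
    exact ⟨k ≫ b t, (hh _ _ _).2 ⟨t, k, rfl, rfl⟩, (hh' _ _ _).2 ⟨t', k', e.symm, rfl⟩⟩

theorem PSpan.inter (h : FinitelyPreComplete K) {A B : K}
    {S S' : ∀ U : K, (U ⟶ A) → (U ⟶ B) → Prop}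
    (hS : PSpan S) (hS' : PSpan S') :
    PSpan (fun U f g => S U f g ∧ S' U f g) := by
  obtain ⟨T, R, a, b, hh⟩ := hS
  obtain ⟨T', R', a', b', hh'⟩ := hS'
  have key : ∀ p : T × T', PSpan (fun U (f : U ⟶ A) (g : U ⟶ B) =>
      ∃ (k : U ⟶ R p.1) (k' : U ⟶ R' p.2), k ≫ a p.1 = k' ≫ a' p.2 ∧ k ≫ b p.1 = k' ≫ b' p.2 ∧
        k ≫ a p.1 = f ∧ k ≫ b p.1 = g) := by
    intro p
    obtain ⟨T₂, R₂, a₂, b₂, hh₂⟩ := prePullback h (a p.1) (a' p.2)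
    have := fun t => preEq h (a₂ t ≫ b p.1) (b₂ t ≫ b' p.2)
    choose T₃ R₃ a₃ hh₃ using this
    refine ⟨Σ t, T₃ t, fun t => R₃ t.1 t.2, fun t => a₃ t.1 t.2 ≫ a₂ t.1 ≫ a p.1,
      fun t => a₃ t.1 t.2 ≫ a₂ t.1 ≫ b p.1, fun U f g => ⟨?_, ?_⟩⟩
    · rintro ⟨k, k', e, e', rfl, rfl⟩
      obtain ⟨t, l, rfl, rfl⟩ := (hh₂ U k k').1 e
      obtain ⟨s, m, rfl⟩ := (hh₃ t U l).1 (by simpa using e')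
      exact ⟨⟨t, s⟩, m, by simp, by simp⟩
    · rintro ⟨⟨t, s⟩, m, rfl, rfl⟩
      refine ⟨(m ≫ a₃ t s) ≫ a₂ t, (m ≫ a₃ t s) ≫ b₂ t, (hh₂ _ _ _).2 ⟨t, _, rfl, rfl⟩, ?_,
        by simp, by simp⟩
      have := (hh₃ t U (m ≫ a₃ t s)).2 ⟨s, m, rfl⟩
      simpa using this
  refine (PSpan.iUnion key).congr fun U f g => ⟨?_, ?_⟩
  · rintro ⟨h1, h2⟩
    obtain ⟨t, k, rfl, rfl⟩ := (hh _ _ _).1 h1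
    obtain ⟨t', k', e, e'⟩ := (hh' _ _ _).1 h2
    exact ⟨⟨t, t'⟩, k, k', e.symm, e'.symm, rfl, rfl⟩
  · rintro ⟨⟨t, t'⟩, k, k', e, e', rfl, rfl⟩
    exact ⟨(hh _ _ _).2 ⟨t, k, rfl, rfl⟩, (hh' _ _ _).2 ⟨t', k', e.symm, e'.symm⟩⟩

/-- The presheaf is generated by a small family of sections. -/
def Gen (F : Kᵒᵖ ⥤ Type v) : Prop :=
  ∃ (I : Type v) (A : I → K) (x : ∀ i, F.obj (op (A i))),
    ∀ (U : K) (y : F.obj (op U)), ∃ (i : I) (g : U ⟶ A i), res F g (x i) = y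

/-- Equality of restrictions of two sections is a small span relation. -/
def Luc (F : Kᵒᵖ ⥤ Type v) : Prop :=
  ∀ (A B : K) (x : F.obj (op A)) (y : F.obj (op B)),
    PSpan (fun U (f : U ⟶ A) (g : U ⟶ B) => res F f x = res F g y)

theorem Gen.of_surj {F G : Kᵒᵖ ⥤ Type v} (hF : Gen F) (α : F ⟶ G)
    (hα : ∀ (U : K) (y : G.obj (op U)), ∃ x : F.obj (op U), apn α x = y) : Gen G := by
  obtain ⟨I, A, x, hx⟩ := hF
  refine ⟨I, A, fun i => apn α (x i), fun U y => ?_⟩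
  obtain ⟨y, rfl⟩ := hα U y
  obtain ⟨i, g, rfl⟩ := hx U y
  exact ⟨i, g, (apn_res _ _ _).symm⟩

theorem Luc.of_inj {F G : Kᵒᵖ ⥤ Type v} (hG : Luc G) (α : F ⟶ G)
    (hα : ∀ (U : K) (x y : F.obj (op U)), apn α x = apn α y → x = y) : Luc F := by
  intro A B x y
  refine (hG A B (apn α x) (apn α y)).congr fun U f g => ⟨fun e => ?_, fun e => ?_⟩
  · rw [← apn_res, ← apn_res, e]
  · rw [← apn_res, ← apn_res] at e
    exact hα _ _ _ e

/-- Zigzags in a category. -/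
inductive Zig {J : Type v} [SmallCategory J] (j : J) : J → Type v
  | nil : Zig j j
  | fwd {k l : J} : Zig j k → (k ⟶ l) → Zig j l
  | bwd {k l : J} : Zig j k → (l ⟶ k) → Zig j l

/-- The relation of being connected via a given zigzag. -/
def ZRel {J : Type v} [SmallCategory J] (D : J ⥤ K) {j : J} :
    ∀ {k : J}, Zig j k → ∀ U : K, (U ⟶ D.obj j) → (U ⟶ D.obj k) → Prop
  | _, .nil => fun _ f g => f ≫ 𝟙 _ = g
  | _, .fwd z u => fun U f g => ∃ m, ZRel D z U f m ∧ m ≫ D.map u = g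
  | _, .bwd z u => fun U f g => ∃ m, ZRel D z U f m ∧ g ≫ D.map u = m

theorem ZRel.pspan (h : FinitelyPreComplete K) {J : Type v} [SmallCategory J] (D : J ⥤ K) {j k : J}
    (z : Zig j k) : PSpan (ZRel D z) := by
  induction z with
  | nil => exact PSpan.graph (𝟙 _)
  | fwd z u ih => exact PSpan.comp h ih (PSpan.graph (D.map u))
  | bwd z u ih => exact PSpan.comp h ih (PSpan.graph (D.map u)).symm

theorem colim_eq {J : Type v} [SmallCategory J] (D : J ⥤ K) (c : Cocone (D ⋙ yoneda))
    (hc : IsColimit c) {U : K} {j k : J} (f : U ⟶ D.obj j) (g : U ⟶ D.obj k) :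
    apn (c.ι.app j) f = apn (c.ι.app k) g ↔ ∃ z : Zig j k, ZRel D z U f g := by
  constructor
  · intro e
    have hU := isColimitOfPreserves ((evaluation Kᵒᵖ (Type v)).obj (op U)) hc
    let s : Cocone ((D ⋙ yoneda) ⋙ (evaluation Kᵒᵖ (Type v)).obj (op U)) :=
      { pt := ULift.{v} Prop
        ι := { app := fun l => ↾(fun (m : U ⟶ D.obj l) => ULift.up (∃ z : Zig j l, ZRel D z U f m))
               naturality := by
                intro l l' u
                ext (m : U ⟶ D.obj l)
                refine congrArg ULift.up (propext ⟨?_, ?_⟩)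
                · rintro ⟨z, hz⟩
                  exact ⟨z.bwd u, _, hz, rfl⟩
                · rintro ⟨z, hz⟩
                  exact ⟨z.fwd u, _, hz, rfl⟩ } }
    have h1 := ConcreteCategory.congr_hom (hU.fac s j) f
    have h2 := ConcreteCategory.congr_hom (hU.fac s k) g
    have h3 : s.ι.app j f = s.ι.app k g := by
      rw [← h1, ← h2]
      exact congrArg (hU.desc s) e
    have h4 : (∃ z : Zig j j, ZRel D z U f f) = (∃ z : Zig j k, ZRel D z U f g) :=
      congrArg ULift.down h3
    rw [← h4]
    exact ⟨.nil, by simp [ZRel]⟩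
  · rintro ⟨z, hz⟩
    have w : ∀ {k l : J} (u : k ⟶ l) (m : U ⟶ D.obj k),
        apn (c.ι.app l) (m ≫ D.map u : U ⟶ D.obj l) = apn (c.ι.app k) m := by
      intro k l u m
      rw [← c.w u, apn_comp]
      rfl
    induction z with
    | nil => simp only [ZRel, Category.comp_id] at hz; rw [hz]
    | fwd z u ih =>
      obtain ⟨m, h1, rfl⟩ := hz
      rw [ih m h1, w]
    | bwd z u ih =>
      obtain ⟨m, h1, rfl⟩ := hz
      rw [ih _ h1, w]

theorem colim_surj {J : Type v} [SmallCategory J] (D : J ⥤ K) (c : Cocone (D ⋙ yoneda))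
    (hc : IsColimit c) {U : K} (x : c.pt.obj (op U)) :
    ∃ (j : J) (f : U ⟶ D.obj j), apn (c.ι.app j) f = x := by
  have hU := isColimitOfPreserves ((evaluation Kᵒᵖ (Type v)).obj (op U)) hc
  exact Types.jointly_surjective _ hU x

theorem apn_yon {A : K} {G : Kᵒᵖ ⥤ Type v} (α : yoneda.obj A ⟶ G) {U : K} (f : U ⟶ A) :
    apn α f = res G f (apn α (𝟙 A)) := by
  rw [← apn_res]
  congr 1
  exact (Category.comp_id f).symm

theorem IsSmallPresheaf.gen {F : Kᵒᵖ ⥤ Type v} (hF : IsSmallPresheaf.{v} F) : Gen F := by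
  obtain ⟨J, _, D, c, ⟨hc⟩, ⟨e⟩⟩ := hF
  refine Gen.of_surj (F := c.pt) ⟨J, D.obj, fun j => apn (c.ι.app j) (𝟙 (D.obj j)), fun U y => ?_⟩
    e.hom (fun U y => ⟨apn e.inv y, ?_⟩)
  · obtain ⟨j, f, rfl⟩ := colim_surj D c hc y
    exact ⟨j, f, (apn_yon _ _).symm⟩
  · rw [← apn_comp]; simp [apn]

theorem IsSmallPresheaf.luc (h : FinitelyPreComplete K) {F : Kᵒᵖ ⥤ Type v}
    (hF : IsSmallPresheaf.{v} F) : Luc F := by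
  obtain ⟨J, _, D, c, ⟨hc⟩, ⟨e⟩⟩ := hF
  refine Luc.of_inj (G := c.pt) ?_ e.inv (fun U x y hxy => ?_)
  · intro A B x y
    obtain ⟨j, a, rfl⟩ := colim_surj D c hc x
    obtain ⟨k, b, rfl⟩ := colim_surj D c hc y
    have h1 : PSpan (fun U (f : U ⟶ D.obj j) (g : U ⟶ D.obj k) => ∃ z : Zig j k, ZRel D z U f g) :=
      PSpan.iUnion fun z => ZRel.pspan h D z
    have h2 := PSpan.comp h (PSpan.comp h (PSpan.graph a) h1) (PSpan.graph b).symm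
    refine h2.congr fun U f g => ?_
    have : ∀ {A : K} {j : J} (a : A ⟶ D.obj j) (f : U ⟶ A),
        res c.pt f (apn (c.ι.app j) a) = apn (c.ι.app j) (f ≫ a : U ⟶ D.obj j) := by
      intro A j a f
      rw [← apn_res]
      rfl
    rw [this, this, colim_eq D c hc]
    constructor
    · intro hz
      exact ⟨_, ⟨_, rfl, hz⟩, rfl⟩
    · rintro ⟨_, ⟨_, rfl, hz⟩, rfl⟩
      exact hz
  · have := congrArg (apn e.hom) hxy
    rw [← apn_comp, ← apn_comp] at this
    simpa [apn] using this

/-- Index type of a small diagram of sections. -/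
structure SecIdx (F : Kᵒᵖ ⥤ Type v) {I : Type v} (A : I → K) (x : ∀ i, F.obj (op (A i))) where
  idx : I

instance (F : Kᵒᵖ ⥤ Type v) {I : Type v} (A : I → K) (x : ∀ i, F.obj (op (A i))) :
    SmallCategory (SecIdx F A x) where
  Hom i j := { f : A i.idx ⟶ A j.idx // res F f (x j.idx) = x i.idx }
  id i := ⟨𝟙 _, res_id _ _⟩
  comp f g := ⟨f.1 ≫ g.1, by rw [← res_res, g.2, f.2]⟩

/-- The tautological diagram. -/
def secD (F : Kᵒᵖ ⥤ Type v) {I : Type v} (A : I → K) (x : ∀ i, F.obj (op (A i))) :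
    SecIdx F A x ⥤ K where
  obj i := A i.idx
  map f := f.1

/-- The tautological cocone. -/
def secC (F : Kᵒᵖ ⥤ Type v) {I : Type v} (A : I → K) (x : ∀ i, F.obj (op (A i))) :
    Cocone (secD F A x ⋙ yoneda) where
  pt := F
  ι := { app := fun i => mkNat (F := yoneda.obj (A i.idx)) (fun U (f : U ⟶ A i.idx) => res F f (x i.idx))
            (fun f g => (res_res F _ _ _).symm)
         naturality := by
          intro i j f
          refine apn_ext fun U (g : U ⟶ A i.idx) => ?_
          have : res F (g ≫ f.1) (x j.idx) = res F g (x i.idx) := by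
            rw [← res_res, f.2]
          exact this }

theorem small_of_gen_luc {F : Kᵒᵖ ⥤ Type v} (hG : Gen F) (hL : Luc F) :
    IsSmallPresheaf.{v} F := by
  obtain ⟨I, A, x, hx⟩ := hG
  have := fun i j => hL _ _ (x i) (x j)
  choose T R a b hh using this
  let I' := I ⊕ (Σ (i j : I), T i j)
  let A' : I' → K := Sum.elim A (fun p => R p.1 p.2.1 p.2.2)
  let x' : ∀ i, F.obj (op (A' i)) := fun i => match i with
    | .inl i => x i
    | .inr p => res F (a p.1 p.2.1 p.2.2) (x p.1)
  choose ii gg hgg using hx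
  refine ⟨SecIdx F A' x', inferInstance, secD F A' x', secC F A' x', ⟨?_⟩, ⟨Iso.refl _⟩⟩
  let L : I → SecIdx F A' x' := fun i => ⟨.inl i⟩
  have key : ∀ (s : Cocone (secD F A' x' ⋙ yoneda)) (U : K) (i j : I) (f : U ⟶ A i) (g : U ⟶ A j),
      res F f (x i) = res F g (x j) →
        apn (F := yoneda.obj (A i)) (s.ι.app (L i)) f =
          apn (F := yoneda.obj (A j)) (s.ι.app (L j)) g := by
    intro s U i j f g e
    obtain ⟨t, k, rfl, rfl⟩ := (hh i j U f g).1 e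
    let M : SecIdx F A' x' := ⟨.inr ⟨i, j, t⟩⟩
    let m₁ : M ⟶ L i := ⟨a i j t, rfl⟩
    have hab : res F (b i j t) (x j) = res F (a i j t) (x i) :=
      ((hh i j _ (a i j t) (b i j t)).2 ⟨t, 𝟙 _, by simp, by simp⟩).symm
    let m₂ : M ⟶ L j := ⟨b i j t, hab⟩
    have e1 := congrArg (fun α => apn (F := yoneda.obj (R i j t)) α k) (s.w m₁)
    have e2 := congrArg (fun α => apn (F := yoneda.obj (R i j t)) α k) (s.w m₂)
    exact e1.trans e2.symm
  let desc : ∀ s : Cocone (secD F A' x' ⋙ yoneda), F ⟶ s.pt := fun s =>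
    mkNat (fun U y => apn (F := yoneda.obj (A _)) (s.ι.app (L (ii U y))) (gg U y)) (by
      intro U V f y
      exact (key s U (ii U (res F f y)) (ii V y) (gg U (res F f y)) (f ≫ gg V y)
        (by rw [hgg, ← res_res, hgg])).trans
        (apn_res (F := yoneda.obj (A _)) (s.ι.app (L (ii V y))) f (gg V y)))
  have facL : ∀ (s : Cocone (secD F A' x' ⋙ yoneda)) (i : I) (U : K) (f : U ⟶ A i),
      apn (desc s) (res F f (x i)) = apn (F := yoneda.obj (A i)) (s.ι.app (L i)) f := by
    intro s i U f
    exact key s U _ _ _ _ (hgg _ _)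
  refine ⟨desc, ?_, ?_⟩
  · rintro s ⟨i | ⟨i, j, t⟩⟩
    · exact apn_ext fun U f => facL s i U f
    · refine apn_ext fun U (f : U ⟶ R i j t) => ?_
      let M : SecIdx F A' x' := ⟨.inr ⟨i, j, t⟩⟩
      let m₁ : M ⟶ L i := ⟨a i j t, rfl⟩
      have e1 := congrArg (fun α => apn (F := yoneda.obj (R i j t)) α f) (s.w m₁)
      refine Eq.trans ?_ e1
      refine Eq.trans ?_ (facL s i U (f ≫ a i j t))
      exact congrArg (apn (desc s)) (res_res F _ _ _)
  · intro s m hm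
    refine apn_ext fun U y => ?_
    have h1 := congrArg (fun α => apn (F := yoneda.obj (A (ii U y))) α (gg U y)) (hm (L (ii U y)))
    have h2 : apn m (res F (gg U y) (x (ii U y))) = apn (desc s) y := h1
    exact (congrArg (apn m) (hgg U y)).symm.trans h2

theorem isSmall_iff (h : FinitelyPreComplete K) (F : Kᵒᵖ ⥤ Type v) :
    IsSmallPresheaf.{v} F ↔ Gen F ∧ Luc F :=
  ⟨fun hF => ⟨hF.gen, hF.luc h⟩, fun hF => small_of_gen_luc hF.1 hF.2⟩

theorem small_yoneda (h : FinitelyPreComplete K) (A : K) :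
    IsSmallPresheaf.{v} (yoneda.obj A) := by
  refine small_of_gen_luc ⟨PUnit, fun _ => A, fun _ => 𝟙 A, fun U y => ⟨⟨⟩, y, ?_⟩⟩ ?_
  · exact Category.comp_id (y : U ⟶ A)
  · intro B C x y
    exact prePullback h (x : B ⟶ A) (y : C ⟶ A)

end Part1
section Part2

open Opposite

variable {K : Type u} [Category.{v} K]

/-- Sections of an object of the completion. -/
abbrev el (F : PCompletion K) (U : K) : Type v := F.obj.obj (op U)

/-- Action of a morphism on sections. -/
def ap {F G : PCompletion K} (f : F ⟶ G) {U : K} (x : el F U) : el G U := apn f.hom x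

theorem ap_res {F G : PCompletion K} (f : F ⟶ G) {U V : K} (k : U ⟶ V) (x : el F V) :
    ap f (res F.obj k x) = res G.obj k (ap f x) := apn_res _ _ _

theorem ap_comp {F G H : PCompletion K} (f : F ⟶ G) (g : G ⟶ H) {U : K} (x : el F U) :
    ap (f ≫ g) x = ap g (ap f x) := apn_comp _ _ _

theorem ap_id {F : PCompletion K} {U : K} (x : el F U) :
    ap (𝟙 F) x = x := rfl

theorem ap_ext {F G : PCompletion K} {f g : F ⟶ G} (h : ∀ (U : K) (x : el F U), ap f x = ap g x) :
    f = g :=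
  ObjectProperty.hom_ext _ (apn_ext h)

/-- Build a morphism from its action on sections. -/
def mkHom {F G : PCompletion K} (φ : ∀ U : K, el F U → el G U)
    (h : ∀ {U V : K} (f : U ⟶ V) (x : el F V), φ U (res F.obj f x) = res G.obj f (φ V x)) :
    F ⟶ G :=
  ObjectProperty.homMk (mkNat φ h)

theorem ap_mkHom {F G : PCompletion K} (φ : ∀ U : K, el F U → el G U)
    (h : ∀ {U V : K} (f : U ⟶ V) (x : el F V), φ U (res F.obj f x) = res G.obj f (φ V x))
    {U : K} (x : el F U) : ap (mkHom φ h) x = φ U x := rfl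

/-- The representable object. -/
def yo (h : FinitelyPreComplete K) (A : K) : PCompletion K := ⟨yoneda.obj A, small_yoneda h A⟩

/-- The morphism from a representable given by a section. -/
def sec (h : FinitelyPreComplete K) {A : K} {F : PCompletion K} (x : el F A) : yo h A ⟶ F :=
  mkHom (F := yo h A) (fun U (k : U ⟶ A) => res F.obj k x) (fun f k => (res_res F.obj _ _ _).symm)

/-- The universal section. -/
def yid (h : FinitelyPreComplete K) (A : K) : el (yo h A) A := 𝟙 A

theorem ap_sec_yid (h : FinitelyPreComplete K) {A : K} {F : PCompletion K} (x : el F A) :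
    ap (sec h x) (yid h A) = x := res_id _ _

theorem sec_comp (h : FinitelyPreComplete K) {A : K} {F G : PCompletion K} (x : el F A)
    (f : F ⟶ G) : sec h x ≫ f = sec h (ap f x) := by
  refine ap_ext fun U k => ?_
  rw [ap_comp]
  exact ap_res f k x

theorem mono_inj (h : FinitelyPreComplete K) {F G : PCompletion K} (f : F ⟶ G) [Mono f]
    {U : K} {x y : el F U} (e : ap f x = ap f y) : x = y := by
  have : sec h x = sec h y := by
    rw [← cancel_mono f, sec_comp, sec_comp, e]
  rw [← ap_sec_yid h x, this, ap_sec_yid]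

theorem mono_of_inj {F G : PCompletion K} (f : F ⟶ G)
    (hf : ∀ (U : K) (x y : el F U), ap f x = ap f y → x = y) : Mono f := by
  refine ⟨fun a b e => ap_ext fun U x => hf _ _ _ ?_⟩
  rw [← ap_comp, ← ap_comp, e]

theorem pb_w {P X Y Z : PCompletion K} {a : P ⟶ X} {b : P ⟶ Y} {f : X ⟶ Z} {g : Y ⟶ Z}
    (hp : IsPullback a b f g) {U : K} (z : el P U) : ap f (ap a z) = ap g (ap b z) := by
  rw [← ap_comp, ← ap_comp, hp.w]

theorem pb_ex (h : FinitelyPreComplete K) {P X Y Z : PCompletion K} {a : P ⟶ X} {b : P ⟶ Y}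
    {f : X ⟶ Z} {g : Y ⟶ Z} (hp : IsPullback a b f g) {U : K} (x : el X U) (y : el Y U)
    (e : ap f x = ap g y) : ∃ z : el P U, ap a z = x ∧ ap b z = y := by
  have w : sec h x ≫ f = sec h y ≫ g := by rw [sec_comp, sec_comp, e]
  refine ⟨ap (hp.lift _ _ w) (yid h U), ?_, ?_⟩
  · rw [← ap_comp, hp.lift_fst, ap_sec_yid]
  · rw [← ap_comp, hp.lift_snd, ap_sec_yid]

theorem pb_uniq (h : FinitelyPreComplete K) {P X Y Z : PCompletion K} {a : P ⟶ X} {b : P ⟶ Y}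
    {f : X ⟶ Z} {g : Y ⟶ Z} (hp : IsPullback a b f g) {U : K} {z z' : el P U}
    (e : ap a z = ap a z') (e' : ap b z = ap b z') : z = z' := by
  have : sec h z = sec h z' := by
    apply hp.hom_ext
    · rw [sec_comp, sec_comp, e]
    · rw [sec_comp, sec_comp, e']
  rw [← ap_sec_yid h z, this, ap_sec_yid]

theorem pb_mk {P X Y Z : PCompletion K} {a : P ⟶ X} {b : P ⟶ Y} {f : X ⟶ Z} {g : Y ⟶ Z}
    (w : ∀ (U : K) (z : el P U), ap f (ap a z) = ap g (ap b z))
    (ex : ∀ (U : K) (x : el X U) (y : el Y U), ap f x = ap g y →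
      ∃ z : el P U, ap a z = x ∧ ap b z = y)
    (un : ∀ (U : K) (z z' : el P U), ap a z = ap a z' → ap b z = ap b z' → z = z') :
    IsPullback a b f g := by
  have w' : a ≫ f = b ≫ g := ap_ext fun U z => by rw [ap_comp, ap_comp, w]
  choose L hL1 hL2 using ex
  refine ⟨⟨w'⟩, ⟨PullbackCone.IsLimit.mk w' (fun s => mkHom (fun U t => L U (ap s.fst t) (ap s.snd t)
    (by rw [← ap_comp, ← ap_comp, s.condition])) ?_) ?_ ?_ ?_⟩⟩
  · intro U V k t
    apply un
    · rw [hL1, ap_res, ap_res, hL1]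
    · rw [hL2, ap_res, ap_res, hL2]
  · intro s
    refine ap_ext fun U t => ?_
    rw [ap_comp, ap_mkHom, hL1]
  · intro s
    refine ap_ext fun U t => ?_
    rw [ap_comp, ap_mkHom, hL2]
  · intro s m h1 h2
    refine ap_ext fun U t => ?_
    apply un
    · rw [ap_mkHom, hL1, ← ap_comp, h1]
    · rw [ap_mkHom, hL2, ← ap_comp, h2]

/-- The fibre product presheaf. -/
def pbPsh {X Y Z : PCompletion K} (f : X ⟶ Z) (g : Y ⟶ Z) : Kᵒᵖ ⥤ Type v :=
  mkPsh (fun U => { p : el X U × el Y U // ap f p.1 = ap g p.2 })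
    (fun k p => ⟨(res X.obj k p.1.1, res Y.obj k p.1.2), by
      simp only [ap_res, p.2]⟩)
    (fun U p => Subtype.ext (Prod.ext (res_id _ _) (res_id _ _)))
    (fun k l p => Subtype.ext (Prod.ext (res_res _ _ _ _) (res_res _ _ _ _)))

theorem pbPsh_small (h : FinitelyPreComplete K) {X Y Z : PCompletion K} (f : X ⟶ Z) (g : Y ⟶ Z) :
    IsSmallPresheaf.{v} (pbPsh f g) := by
  apply small_of_gen_luc
  · obtain ⟨I, A, x, hx⟩ := X.2.gen
    obtain ⟨J, B, y, hy⟩ := Y.2.gen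
    have := fun i j => Z.2.luc h _ _ (ap f (x i)) (ap g (y j))
    choose T R a b hh using this
    refine ⟨Σ (i : I) (j : J), T i j, fun p => R p.1 p.2.1 p.2.2,
      fun p => ⟨(res X.obj (a p.1 p.2.1 p.2.2) (x p.1), res Y.obj (b p.1 p.2.1 p.2.2) (y p.2.1)), ?_⟩, ?_⟩
    · simp only [ap_res]
      exact (hh _ _ _ _ _).2 ⟨p.2.2, 𝟙 _, by simp, by simp⟩
    · rintro U ⟨⟨p, q⟩, hpq⟩
      obtain ⟨i, k, rfl⟩ := hx U p
      obtain ⟨j, l, rfl⟩ := hy U q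
      simp only [ap_res] at hpq
      obtain ⟨t, m, rfl, rfl⟩ := (hh i j U k l).1 hpq
      refine ⟨⟨i, j, t⟩, m, Subtype.ext (Prod.ext ?_ ?_)⟩
      · exact res_res _ _ _ _
      · exact res_res _ _ _ _
  · intro A B p q
    refine (PSpan.inter h (X.2.luc h _ _ p.1.1 q.1.1) (Y.2.luc h _ _ p.1.2 q.1.2)).congr ?_
    intro U k l
    constructor
    · intro e
      exact ⟨congrArg (fun z => z.1.1) e, congrArg (fun z => z.1.2) e⟩
    · rintro ⟨e1, e2⟩
      exact Subtype.ext (Prod.ext e1 e2)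

theorem exists_pb (h : FinitelyPreComplete K) {X Y Z : PCompletion K} (f : X ⟶ Z) (g : Y ⟶ Z) :
    ∃ (P : PCompletion K) (a : P ⟶ X) (b : P ⟶ Y), IsPullback a b f g := by
  let P : PCompletion K := ⟨pbPsh f g, pbPsh_small h f g⟩
  refine ⟨P, mkHom (F := P) (fun U p => p.1.1) (fun _ _ => rfl),
    mkHom (F := P) (fun U p => p.1.2) (fun _ _ => rfl), pb_mk ?_ ?_ ?_⟩
  · intro U z
    exact z.2
  · intro U x y e
    exact ⟨⟨(x, y), e⟩, rfl, rfl⟩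
  · intro U z z' e e'
    exact Subtype.ext (Prod.ext e e')

theorem hasFiniteLimits (h : FinitelyPreComplete K) : HasFiniteLimits (PCompletion K) := by
  have : HasPullbacks (PCompletion K) := by
    apply +allowSynthFailures hasPullbacks_of_hasLimit_cospan
    intro X Y Z f g
    obtain ⟨P, a, b, hp⟩ := exists_pb h f g
    exact hp.hasPullback
  have : HasTerminal (PCompletion K) := by
    let T : Kᵒᵖ ⥤ Type v := mkPsh (fun _ => PUnit) (fun _ _ => ⟨⟩) (fun _ _ => rfl) (fun _ _ _ => rfl)
    have hT : IsSmallPresheaf.{v} T := by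
      apply small_of_gen_luc
      · obtain ⟨I, R, hR⟩ := preTerm h
        refine ⟨I, R, fun _ => ⟨⟩, fun U y => ?_⟩
        obtain ⟨t, ⟨k⟩⟩ := hR U
        exact ⟨t, k, rfl⟩
      · intro A B x y
        exact (preProd h A B).congr fun U f g => ⟨fun _ => trivial, fun _ => rfl⟩
    let T' : PCompletion K := ⟨T, hT⟩
    exact IsTerminal.hasTerminal (X := T') (IsTerminal.ofUniqueHom
      (fun X => mkHom (G := T') (fun _ _ => ⟨⟩) (fun _ _ => rfl)) (fun X m => ap_ext fun U x => rfl))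
  exact hasFiniteLimits_of_hasTerminal_and_pullbacks

/-- The quotient presheaf. -/
def quo (X : Kᵒᵖ ⥤ Type v) (s : ∀ U : K, Setoid (X.obj (op U)))
    (hs : ∀ {U V : K} (k : U ⟶ V) (x y : X.obj (op V)), s V x y → s U (res X k x) (res X k y)) :
    Kᵒᵖ ⥤ Type v :=
  mkPsh (fun U => Quotient (s U)) (fun k => Quotient.map (res X k) (hs k))
    (fun U x => by
      induction x using Quotient.inductionOn with | _ x => exact congrArg _ (res_id X x))
    (fun k l x => by
      induction x using Quotient.inductionOn with | _ x => exact congrArg _ (res_res X k l x))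

theorem quo_small (h : FinitelyPreComplete K) {X : Kᵒᵖ ⥤ Type v} (hX : IsSmallPresheaf.{v} X)
    (s : ∀ U : K, Setoid (X.obj (op U)))
    (hs : ∀ {U V : K} (k : U ⟶ V) (x y : X.obj (op V)), s V x y → s U (res X k x) (res X k y))
    (hp : ∃ (I : Type v) (C : I → K) (r₁ r₂ : ∀ i, X.obj (op (C i))),
      ∀ (U : K) (x y : X.obj (op U)), s U x y ↔
        ∃ (i : I) (k : U ⟶ C i), x = res X k (r₁ i) ∧ res X k (r₂ i) = y) :
    IsSmallPresheaf.{v} (quo X s hs) := by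
  apply small_of_gen_luc
  · refine hX.gen.of_surj (mkNat (G := quo X s hs) (fun U x => Quotient.mk (s U) x)
      (fun _ _ => rfl)) ?_
    intro U y
    obtain ⟨x, rfl⟩ := Quotient.exists_rep y
    exact ⟨x, rfl⟩
  · intro A B x y
    obtain ⟨x, rfl⟩ := Quotient.exists_rep x
    obtain ⟨y, rfl⟩ := Quotient.exists_rep y
    obtain ⟨I, C, r₁, r₂, hr⟩ := hp
    refine (PSpan.iUnion (fun i => PSpan.comp h (hX.luc h _ _ x (r₁ i))
      (hX.luc h _ _ (r₂ i) y))).congr fun U f g => ?_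
    have : (res (quo X s hs) f (Quotient.mk (s A) x) = res (quo X s hs) g (Quotient.mk (s B) y)) ↔
      s U (res X f x) (res X g y) := Quotient.eq (r := s U)
    exact this.trans (hr _ _ _)

/-- Two copies of a presheaf. -/
def dbl (G : Kᵒᵖ ⥤ Type v) : Kᵒᵖ ⥤ Type v :=
  mkPsh (fun U => G.obj (op U) × Bool) (fun k p => (res G k p.1, p.2))
    (fun U p => Prod.ext (res_id _ _) rfl) (fun k l p => Prod.ext (res_res _ _ _ _) rfl)

theorem dbl_small (h : FinitelyPreComplete K) {G : Kᵒᵖ ⥤ Type v} (hG : IsSmallPresheaf.{v} G) :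
    IsSmallPresheaf.{v} (dbl G) := by
  apply small_of_gen_luc
  · obtain ⟨I, A, x, hx⟩ := hG.gen
    refine ⟨I × Bool, fun p => A p.1, fun p => (x p.1, p.2), ?_⟩
    rintro U ⟨y, b⟩
    obtain ⟨i, k, rfl⟩ := hx U y
    exact ⟨(i, b), k, rfl⟩
  · rintro A B ⟨x, b⟩ ⟨y, c⟩
    by_cases hbc : b = c
    · refine (hG.luc h _ _ x y).congr fun U f g => ⟨fun e => congrArg Prod.fst e, fun e => ?_⟩
      exact Prod.ext e hbc
    · exact PSpan.empty.congr fun U f g => ⟨fun e => hbc (congrArg Prod.snd e), False.elim⟩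

/-- The cokernel pair relation. -/
def ckS {F G : PCompletion K} (f : F ⟶ G) (U : K) : Setoid ((dbl G.obj).obj (op U)) where
  r p q := p.1 = q.1 ∧ (p.2 = q.2 ∨ ∃ x : el F U, ap f x = p.1)
  iseqv :=
    { refl := fun p => ⟨rfl, .inl rfl⟩
      symm := by
        rintro p q ⟨e, e'⟩
        refine ⟨e.symm, ?_⟩
        rw [← e]
        exact e'.imp_left Eq.symm
      trans := by
        rintro p q r ⟨e, e'⟩ ⟨d, d'⟩
        refine ⟨e.trans d, ?_⟩
        rw [← e] at d'
        rcases e' with e' | e'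
        · rw [e']; exact d'
        · exact .inr e' }

theorem ckS_res {F G : PCompletion K} (f : F ⟶ G) {U V : K} (k : U ⟶ V)
    (p q : (dbl G.obj).obj (op V)) (e : ckS f V p q) :
    ckS f U (res (dbl G.obj) k p) (res (dbl G.obj) k q) := by
  obtain ⟨e, e'⟩ := e
  refine ⟨congrArg (res G.obj k) e, e'.imp id ?_⟩
  rintro ⟨x, hx⟩
  exact ⟨res F.obj k x, (ap_res f k x).trans (congrArg (res G.obj k) hx)⟩

theorem ck_small (h : FinitelyPreComplete K) {F G : PCompletion K} (f : F ⟶ G) :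
    IsSmallPresheaf.{v} (quo (dbl G.obj) (ckS f) (ckS_res f)) := by
  refine quo_small h (dbl_small h G.2) _ _ ?_
  obtain ⟨I, A, x, hx⟩ := G.2.gen
  obtain ⟨J, B, y, hy⟩ := F.2.gen
  refine ⟨(I × Bool) ⊕ (J × Bool × Bool), Sum.elim (fun p => A p.1) (fun p => B p.1),
    fun t => match t with
      | .inl p => (x p.1, p.2)
      | .inr p => (ap f (y p.1), p.2.1),
    fun t => match t with
      | .inl p => (x p.1, p.2)
      | .inr p => (ap f (y p.1), p.2.2), ?_⟩
  rintro U ⟨p, b⟩ ⟨q, c⟩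
  constructor
  · rintro ⟨e, e'⟩
    have e : p = q := e
    subst e
    rcases e' with e' | ⟨z, hz⟩
    · have e' : b = c := e'
      subst e'
      obtain ⟨i, k, rfl⟩ := hx U p
      exact ⟨.inl (i, b), k, rfl, rfl⟩
    · have hz : ap f z = p := hz
      subst hz
      obtain ⟨j, k, rfl⟩ := hy U z
      refine ⟨.inr (j, b, c), k, Prod.ext (ap_res _ _ _) rfl, Prod.ext (ap_res _ _ _).symm rfl⟩
  · rintro ⟨i | j, k, e, e'⟩
    · exact ⟨(congrArg Prod.fst e).trans (congrArg Prod.fst e'),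
        .inl ((congrArg Prod.snd e).trans (congrArg Prod.snd e'))⟩
    · have e1 : p = res G.obj k (ap f (y j.1)) := congrArg Prod.fst e
      have e2 : res G.obj k (ap f (y j.1)) = q := congrArg Prod.fst e'
      exact ⟨e1.trans e2, .inr ⟨res F.obj k (y j.1), (ap_res _ _ _).trans e1.symm⟩⟩

theorem exists_ck (h : FinitelyPreComplete K) {F G : PCompletion K} (f : F ⟶ G) :
    ∃ (C : PCompletion K) (a b : G ⟶ C), f ≫ a = f ≫ b ∧
      ∀ (U : K) (y : el G U), ap a y = ap b y → ∃ x : el F U, ap f x = y := by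
  let C : PCompletion K := ⟨_, ck_small h f⟩
  let i : Bool → (G ⟶ C) := fun b =>
    mkHom (G := C) (fun U y => Quotient.mk (ckS f U) (y, b)) (fun _ _ => rfl)
  refine ⟨C, i true, i false, ap_ext fun U x => ?_, fun U y e => ?_⟩
  · rw [ap_comp, ap_comp]
    exact Quotient.sound (s := ckS f U) ⟨rfl, .inr ⟨x, rfl⟩⟩
  · have := Quotient.exact (s := ckS f U) e
    rcases this with ⟨-, e | e⟩
    · exact absurd (show true = false from e) (by simp)
    · exact e

theorem epi_surj (h : FinitelyPreComplete K) {F G : PCompletion K} (f : F ⟶ G) [Epi f]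
    {U : K} (y : el G U) : ∃ x : el F U, ap f x = y := by
  obtain ⟨C, a, b, e, hC⟩ := exists_ck h f
  exact hC U y (by rw [(cancel_epi f).1 e])

theorem regMono (h : FinitelyPreComplete K) {F G : PCompletion K} (f : F ⟶ G) (hf : Mono f) :
    Nonempty (RegularMono f) := by
  obtain ⟨C, a, b, e, hC⟩ := exists_ck h f
  refine ⟨⟨C, a, b, e, Fork.IsLimit.mk' _ fun s => ?_⟩⟩
  have ex : ∀ (U : K) (t : el s.pt U), ∃ x : el F U, ap f x = ap s.ι t := by
    intro U t
    apply hC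
    rw [← ap_comp, ← ap_comp, s.condition]
  choose L hL using ex
  have hnat : ∀ {U V : K} (k : U ⟶ V) (t : el s.pt V),
      L U (res s.pt.obj k t) = res F.obj k (L V t) := by
    intro U V k t
    apply mono_inj h f
    rw [hL, ap_res, ap_res, hL]
  refine ⟨mkHom (F := s.pt) (G := F) L hnat, ap_ext fun U t => hL U t,
    fun {m} hm => ap_ext fun U t => mono_inj h f ?_⟩
  exact ((ap_comp m f t).symm.trans (congrArg (fun q => ap q t) hm)).trans (hL U t).symm

theorem regEpi (h : FinitelyPreComplete K) {F G : PCompletion K} (f : F ⟶ G)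
    (hf : ∀ (U : K) (y : el G U), ∃ x : el F U, ap f x = y) :
    Nonempty (RegularEpi f) := by
  obtain ⟨P, a, b, hp⟩ := exists_pb h f f
  refine ⟨⟨P, a, b, hp.w, Cofork.IsColimit.mk' _ fun s => ?_⟩⟩
  choose L hL using hf
  have key : ∀ (U : K) (x y : el F U), ap f x = ap f y → ap s.π x = ap s.π y := by
    intro U x y e
    obtain ⟨z, rfl, rfl⟩ := pb_ex h hp x y e
    rw [← ap_comp, ← ap_comp, s.condition]
  have hnat : ∀ {U V : K} (k : U ⟶ V) (y : el G V),
      ap s.π (L U (res G.obj k y)) = res s.pt.obj k (ap s.π (L V y)) := by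
    intro U V k y
    rw [← ap_res]
    apply key
    rw [hL, ap_res, hL]
  refine ⟨mkHom (F := G) (G := s.pt) (fun U y => ap s.π (L U y)) hnat,
    ap_ext fun U x => key _ _ _ (hL _ _), fun {m} hm => ap_ext fun U y => ?_⟩
  have e : ap (f ≫ m) (L U y) = ap s.π (L U y) := congrArg (fun q => ap q _) hm
  rw [ap_comp, hL] at e
  exact e

theorem exists_image (h : FinitelyPreComplete K) {X Y : PCompletion K} (f : X ⟶ Y) :
    ∃ (Z : PCompletion K) (e : X ⟶ Z) (m : Z ⟶ Y),
      e ≫ m = f ∧ Nonempty (RegularEpi e) ∧ Mono m := by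
  let Z : Kᵒᵖ ⥤ Type v := mkPsh (fun U => { y : el Y U // ∃ x : el X U, ap f x = y })
    (fun k y => ⟨res Y.obj k y.1, by
      obtain ⟨y, x, rfl⟩ := y
      exact ⟨res X.obj k x, ap_res _ _ _⟩⟩)
    (fun _ _ => Subtype.ext (res_id _ _)) (fun _ _ _ => Subtype.ext (res_res _ _ _ _))
  have hZ : IsSmallPresheaf.{v} Z := by
    apply small_of_gen_luc
    · refine X.2.gen.of_surj (mkNat (G := Z) (fun U x => ⟨ap f x, x, rfl⟩)
        (fun k x => Subtype.ext (ap_res _ _ _))) ?_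
      rintro U ⟨y, x, rfl⟩
      exact ⟨x, rfl⟩
    · refine (Y.2.luc h).of_inj (mkNat (F := Z) (fun U y => y.1) (fun k x => rfl)) ?_
      intro U x y e
      exact Subtype.ext e
  let Z' : PCompletion K := ⟨Z, hZ⟩
  refine ⟨Z', mkHom (G := Z') (fun U x => ⟨ap f x, x, rfl⟩) (fun k x => Subtype.ext (ap_res _ _ _)),
    mkHom (F := Z') (fun U y => y.1) (fun k x => rfl), ?_, regEpi h _ ?_, mono_of_inj _ ?_⟩
  · exact ap_ext fun U x => rfl
  · rintro U ⟨y, x, rfl⟩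
    exact ⟨x, rfl⟩
  · intro U x y e
    exact Subtype.ext e

theorem effective (h : FinitelyPreComplete K) {R X : PCompletion K} (r₁ r₂ : R ⟶ X)
    (hR : IsEquivalenceRelationPair r₁ r₂) :
    ∃ (Y : PCompletion K) (f : X ⟶ Y), IsPullback r₁ r₂ f f := by
  let s : ∀ U : K, Setoid (el X U) := fun U =>
    { r := fun x y => ∃ z : el R U, ap r₁ z = x ∧ ap r₂ z = y
      iseqv :=
        { refl := by
            intro x
            obtain ⟨d, h1, h2⟩ := hR.refl (sec h x)
            refine ⟨ap d (yid h U), ?_, ?_⟩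
            · rw [← ap_comp, h1, ap_sec_yid]
            · rw [← ap_comp, h2, ap_sec_yid]
          symm := by
            rintro x y ⟨z, rfl, rfl⟩
            obtain ⟨t, h1, h2⟩ := hR.symm
            refine ⟨ap t z, ?_, ?_⟩
            · rw [← ap_comp, h1]
            · rw [← ap_comp, h2]
          trans := by
            rintro x y w ⟨z, rfl, rfl⟩ ⟨z', e, rfl⟩
            obtain ⟨t, h1, h2⟩ := hR.trans (sec h z) (sec h z') (by rw [sec_comp, sec_comp, e])
            refine ⟨ap t (yid h U), ?_, ?_⟩
            · rw [← ap_comp, h1, ap_comp, ap_sec_yid]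
            · rw [← ap_comp, h2, ap_comp, ap_sec_yid] } }
  have hs : ∀ {U V : K} (k : U ⟶ V) (x y : el X V), s V x y →
      s U (res X.obj k x) (res X.obj k y) := by
    rintro U V k x y ⟨z, rfl, rfl⟩
    exact ⟨res R.obj k z, ap_res _ _ _, ap_res _ _ _⟩
  have hsm : IsSmallPresheaf.{v} (quo X.obj s hs) := by
    refine quo_small h X.2 s hs ?_
    obtain ⟨I, A, x, hx⟩ := R.2.gen
    refine ⟨I, A, fun i => ap r₁ (x i), fun i => ap r₂ (x i), fun U p q => ⟨?_, ?_⟩⟩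
    · rintro ⟨z, rfl, rfl⟩
      obtain ⟨i, k, rfl⟩ := hx U z
      exact ⟨i, k, ap_res _ _ _, (ap_res _ _ _).symm⟩
    · rintro ⟨i, k, rfl, rfl⟩
      exact ⟨res R.obj k (x i), ap_res _ _ _, ap_res _ _ _⟩
  let Y : PCompletion K := ⟨_, hsm⟩
  refine ⟨Y, mkHom (G := Y) (fun U x => Quotient.mk (s U) x) (fun _ _ => rfl), pb_mk ?_ ?_ ?_⟩
  · intro U z
    exact Quotient.sound (s := s U) ⟨z, rfl, rfl⟩
  · intro U x y e
    exact Quotient.exact (s := s U) e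
  · intro U z z' e e'
    have := hR.jointlyMono (sec h z) (sec h z') (by rw [sec_comp, sec_comp, e])
      (by rw [sec_comp, sec_comp, e'])
    rw [← ap_sec_yid h z, this, ap_sec_yid]

/-- Sectionwise coproduct cofans. -/
def CofanEl {I : Type w} {X : I → PCompletion K} (c : Cofan X) : Prop :=
  (∀ (U : K) (y : el c.pt U), ∃ (i : I) (x : el (X i) U), ap (c.inj i) x = y) ∧
  (∀ (U : K) (i j : I) (x : el (X i) U) (y : el (X j) U), ap (c.inj i) x = ap (c.inj j) y →
    (⟨i, x⟩ : Σ i, el (X i) U) = ⟨j, y⟩)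

theorem CofanEl.isColimit {I : Type w} {X : I → PCompletion K} {c : Cofan X} (hc : CofanEl c) :
    Nonempty (IsColimit c) := by
  obtain ⟨h1, h2⟩ := hc
  choose ii xx hxx using h1
  have key : ∀ (s : Cofan X) (U : K) (i j : I) (x : el (X i) U) (y : el (X j) U),
      ap (c.inj i) x = ap (c.inj j) y → ap (s.inj i) x = ap (s.inj j) y := by
    intro s U i j x y e
    have := h2 U i j x y e
    cases this
    rfl
  refine ⟨mkCofanColimit c (fun s => mkHom (fun U y => ap (s.inj _) (xx U y)) ?_) ?_ ?_⟩
  · intro U V k y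
    rw [← ap_res]
    apply key
    rw [hxx, ap_res, hxx]
  · intro s j
    refine ap_ext fun U x => ?_
    rw [ap_comp, ap_mkHom]
    exact key _ _ _ _ _ _ (hxx _ _)
  · intro s m hm
    refine ap_ext fun U y => ?_
    rw [ap_mkHom, ← hm, ap_comp, hxx]

/-- Restriction on disjoint unions of sections. -/
def sres {I : Type w} (X : I → PCompletion K) {U V : K} (k : U ⟶ V) (p : Σ i, el (X i) V) :
    Σ i, el (X i) U :=
  ⟨p.1, res (X p.1).obj k p.2⟩

theorem sres_id {I : Type w} (X : I → PCompletion K) {U : K} (p : Σ i, el (X i) U) :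
    sres X (𝟙 U) p = p := by
  obtain ⟨i, x⟩ := p
  exact congrArg (Sigma.mk i) (res_id (X i).obj x)

/-- The coproduct presheaf. -/
noncomputable def sigPsh {I : Type w} [Small.{v} I] (X : I → PCompletion K) : Kᵒᵖ ⥤ Type v :=
  mkPsh (fun U => Shrink.{v} (Σ i, el (X i) U))
    (fun k p => equivShrink _ (sres X k ((equivShrink _).symm p)))
    (fun U p => by rw [sres_id, Equiv.apply_symm_apply])
    (fun k l p => by
      rw [Equiv.symm_apply_apply]
      exact congrArg (fun z => equivShrink _ (Sigma.mk _ z)) (res_res _ _ _ _))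

theorem sig_res {I : Type w} [Small.{v} I] (X : I → PCompletion K) {U V : K} (k : U ⟶ V)
    (p : Σ i, el (X i) V) :
    res (sigPsh X) k (equivShrink (Σ i, el (X i) V) p) =
      equivShrink (Σ i, el (X i) U) (sres X k p) :=
  congrArg (fun z => equivShrink _ (sres X k z)) (Equiv.symm_apply_apply _ _)

theorem Gen.of_small {F : Kᵒᵖ ⥤ Type v} {I : Type w} [Small.{v} I] (A : I → K)
    (x : ∀ i, F.obj (op (A i)))
    (hx : ∀ (U : K) (y : F.obj (op U)), ∃ (i : I) (g : U ⟶ A i), res F g (x i) = y) : Gen F := by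
  refine ⟨Shrink.{v} I, fun p => A ((equivShrink I).symm p),
    fun p => x ((equivShrink I).symm p), fun U y => ?_⟩
  obtain ⟨i, g, hg⟩ := hx U y
  obtain ⟨q, rfl⟩ := (equivShrink I).symm.surjective i
  exact ⟨q, g, hg⟩

theorem exists_sig (h : FinitelyPreComplete K) {I : Type w} [Small.{v} I] (X : I → PCompletion K) :
    ∃ c : Cofan X, CofanEl c := by
  have hsm : IsSmallPresheaf.{v} (sigPsh X) := by
    apply small_of_gen_luc
    · have := fun i => (X i).2.gen
      choose T A x hx using this
      refine Gen.of_small (I := Σ i, T i) (fun p => A p.1 p.2)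
        (fun p => equivShrink (Σ i, el (X i) (A p.1 p.2)) ⟨p.1, x p.1 p.2⟩) fun U y => ?_
      obtain ⟨⟨i, y⟩, rfl⟩ := (equivShrink (Σ i, el (X i) U)).surjective y
      obtain ⟨t, g, rfl⟩ := hx i U y
      exact ⟨⟨i, t⟩, g, sig_res X g _⟩
    · intro A B p q
      obtain ⟨⟨i, x⟩, rfl⟩ := (equivShrink _).surjective p
      obtain ⟨⟨j, y⟩, rfl⟩ := (equivShrink _).surjective q
      have key : ∀ (U : K) (f : U ⟶ A) (g : U ⟶ B),
        (res (sigPsh X) f (equivShrink _ ⟨i, x⟩) = res (sigPsh X) g (equivShrink _ ⟨j, y⟩)) ↔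
        (⟨i, res _ f x⟩ : Σ i, el (X i) U) = ⟨j, res _ g y⟩ := by
        intro U f g
        rw [sig_res, sig_res]
        exact (equivShrink _).injective.eq_iff
      by_cases hij : i = j
      · subst hij
        refine ((X i).2.luc h _ _ x y).congr fun U f g => (key U f g).trans ?_
        simp
      · refine PSpan.empty.congr fun U f g => (key U f g).trans ?_
        simp [hij]
  let S : PCompletion K := ⟨_, hsm⟩
  refine ⟨Cofan.mk S fun i => mkHom (G := S) (fun U x => equivShrink _ ⟨i, x⟩) ?_, ?_, ?_⟩
  · intro U V k x
    exact (sig_res X k ⟨i, x⟩).symm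
  · intro U y
    obtain ⟨⟨i, x⟩, rfl⟩ := (equivShrink _).surjective y
    exact ⟨i, x, rfl⟩
  · intro U i j x y e
    exact (equivShrink _).injective e

theorem cofanEl_of_isColimit (h : FinitelyPreComplete K) {I : Type w} [Small.{v} I]
    {X : I → PCompletion K} {c : Cofan X} (hc : IsColimit c) : CofanEl c := by
  obtain ⟨d, hd⟩ := exists_sig h X
  obtain ⟨hd'⟩ := hd.isColimit
  let e := hc.coconePointUniqueUpToIso hd'
  have he : ∀ i, c.inj i ≫ e.hom = d.inj i := fun i =>
    hc.comp_coconePointUniqueUpToIso_hom hd' ⟨i⟩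
  have he' : ∀ i, d.inj i ≫ e.inv = c.inj i := fun i =>
    hc.comp_coconePointUniqueUpToIso_inv hd' ⟨i⟩
  constructor
  · intro U y
    obtain ⟨i, x, hx⟩ := hd.1 U (ap e.hom y)
    refine ⟨i, x, ?_⟩
    rw [← he', ap_comp, hx, ← ap_comp, e.hom_inv_id, ap_id]
  · intro U i j x y hxy
    apply hd.2
    rw [← he, ← he, ap_comp, ap_comp, hxy]

theorem cofan_univ_disj (h : FinitelyPreComplete K) {I : Type w} [Small.{v} I]
    (X : I → PCompletion K) (c : Cofan X) (hc : Nonempty (IsColimit c)) :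
    CofanUniversal c ∧ CofanDisjoint c := by
  obtain ⟨hc⟩ := hc
  have hel := cofanEl_of_isColimit h hc
  refine ⟨?_, ?_, ?_⟩
  · intro W g Y p q hp
    apply CofanEl.isColimit
    constructor
    · intro U y
      obtain ⟨i, x, hx⟩ := hel.1 U (ap g y)
      obtain ⟨z, hz, -⟩ := pb_ex h (hp i) y x hx.symm
      exact ⟨i, z, hz⟩
    · intro U i j x y e
      have e : ap (p i) x = ap (p j) y := e
      have := hel.2 U i j (ap (q i) x) (ap (q j) y)
        (by rw [← pb_w (hp i), ← pb_w (hp j), e])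
      obtain ⟨rfl, h2⟩ := Sigma.mk.inj_iff.1 this
      rw [pb_uniq h (hp i) e (eq_of_heq h2)]
  · intro i
    refine mono_of_inj _ fun U x y e => ?_
    have := hel.2 U i i x y e
    simpa using this
  · intro i j hij Z u' v' hp
    have hE : ∀ U, el Z U → False := by
      intro U z
      have := hel.2 U i j (ap u' z) (ap v' z) (pb_w hp z)
      exact hij (congrArg Sigma.fst this)
    exact ⟨IsInitial.ofUniqueHom (fun X => mkHom (fun U z => (hE U z).elim)
      (fun k z => (hE _ z).elim)) (fun X m => ap_ext fun U z => (hE U z).elim)⟩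

end Part2

/-- Lemma 4.1 and Remark 4.2: if `𝒦` is finitely pre-complete, then
`𝒫𝒦` is a pretopos; moreover it is infinitary extensive, every monomorphism in it is
regular and every epimorphism in it is regular. -/
theorem pCompletion_isPretopos (K : Type u) [Category.{v} K]
    (h : FinitelyPreComplete K) :
    IsPretopos (PCompletion K) ∧ IsInfinitaryExtensive.{v} (PCompletion K) ∧
    (∀ {F G : PCompletion K} (f : F ⟶ G), Mono f → Nonempty (RegularMono f)) ∧
    (∀ {F G : PCompletion K} (f : F ⟶ G), Epi f → Nonempty (RegularEpi f)) := by
  have hfl := hasFiniteLimits h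
  have hcop : HasCoproducts.{v} (PCompletion K) := by
    intro I
    refine ⟨fun F => ?_⟩
    obtain ⟨c, hc⟩ := exists_sig h (F.obj ∘ Discrete.mk)
    obtain ⟨hc⟩ := hc.isColimit
    have : HasColimit (Discrete.functor (F.obj ∘ Discrete.mk)) := ⟨⟨⟨c, hc⟩⟩⟩
    exact hasColimit_of_iso Discrete.natIsoFunctor
  have hfc : HasFiniteCoproducts (PCompletion K) := hasFiniteCoproducts_of_hasCoproducts.{v} _
  refine ⟨⟨⟨⟨hfl, fun f => exists_image h f, ?_⟩, fun r₁ r₂ hR => effective h r₁ r₂ hR⟩,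
    hfl, hfc, fun I _ X c hc => cofan_univ_disj h X c hc⟩,
    ⟨hfl, hcop, fun I X c hc => cofan_univ_disj h X c hc⟩, fun f hf => regMono h f hf,
    fun f hf => regEpi h f fun U y => epi_surj h f y⟩
  rintro P X Y Z a b f g hp ⟨hg⟩
  have : Epi g := hg.epi
  refine regEpi h a fun U x => ?_
  obtain ⟨y, hy⟩ := epi_surj h g (ap f x)
  obtain ⟨z, hz, -⟩ := pb_ex h hp x y hy.symm
  exact ⟨z, hz⟩
end FreeCompletions
end

section
/- If 𝒦 is a wellpowered, locally small category in which every morphism is a monomorphism, then the free colimit completion 𝒫𝒦 is cowellpowered. -/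
/- Common definitions for formalizing "How nice are free completions of categories?"
   by Adámek and Rosický. -/

open CategoryTheory CategoryTheory.Limits

universe w w₁ w₂ v₁ u₁

namespace FreeCompletions

universe v u

/-- The support of the presheaf is essentially small. -/
def EssSupp {K : Type u} [Category.{v} K] (F : Kᵒᵖ ⥤ Type v) : Prop :=
  ∃ (T : Type v) (A : T → K), ∀ X : K, Nonempty (F.obj (Opposite.op X)) →
    ∃ t, Nonempty (X ≅ A t)

theorem essSupp_of_isSmall {K : Type u} [Category.{v} K]
    (hwp : Wellpowered.{v} K) (hmono : ∀ {X Y : K} (f : X ⟶ Y), Mono f)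
    (F : Kᵒᵖ ⥤ Type v) (hF : IsSmallPresheaf.{v} F) : EssSupp F := by
  obtain ⟨J, _, D, c, ⟨hc⟩, ⟨e⟩⟩ := hF
  have : ∀ j, Small.{v} (Subobject (D.obj j)) := fun j => hwp _
  refine ⟨Σ j : J, Shrink.{v} (Subobject (D.obj j)),
    fun p => (((equivShrink _).symm p.2 : Subobject (D.obj p.1)) : K), ?_⟩
  rintro X ⟨x⟩
  have h := isColimitOfPreserves ((evaluation Kᵒᵖ (Type v)).obj (Opposite.op X)) hc
  obtain ⟨j, f, -⟩ := Types.jointly_surjective _ h (e.inv.app (Opposite.op X) x)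
  change X ⟶ D.obj j at f
  have := hmono f
  refine ⟨⟨j, equivShrink _ (Subobject.mk f)⟩, ⟨?_⟩⟩
  exact (Subobject.underlyingIso f).symm ≪≫ eqToIso (by simp)

theorem isSmall_of_essSupp {K : Type u} [Category.{v} K]
    (F : Kᵒᵖ ⥤ Type v) (hF : EssSupp F) : IsSmallPresheaf.{v} F := by
  obtain ⟨T, A, hA⟩ := hF
  let g : (Σ t : T, F.obj (Opposite.op (A t))) → CostructuredArrow yoneda F :=
    fun p => CostructuredArrow.mk (yonedaEquiv.symm p.2)
  let I : InducedCategory _ g ⥤ CostructuredArrow yoneda F := inducedFunctor g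
  have : I.Full := InducedCategory.full g
  have : I.Faithful := InducedCategory.faithful g
  have : I.EssSurj := ⟨fun Y => by
    obtain ⟨t, ⟨i⟩⟩ := hA Y.left ⟨yonedaEquiv Y.hom⟩
    refine ⟨⟨t, yonedaEquiv (yoneda.map i.inv ≫ Y.hom)⟩, ⟨?_⟩⟩
    refine CostructuredArrow.isoMk i.symm ?_
    change _ = yonedaEquiv.symm _
    simp⟩
  have : I.IsEquivalence := {}
  exact ⟨InducedCategory _ g, inferInstance, I ⋙ CostructuredArrow.proj yoneda F,
    (Presheaf.tautologicalCocone F).whisker I,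
    ⟨(Functor.Final.isColimitWhiskerEquiv I _).symm (Presheaf.isColimitTautologicalCocone F)⟩,
    ⟨Iso.refl _⟩⟩

theorem surjective_of_epi {K : Type u} [Category.{v} K]
    (hwp : Wellpowered.{v} K) (hmono : ∀ {X Y : K} (f : X ⟶ Y), Mono f)
    {F G : PCompletion K} (e : F ⟶ G) [Epi e] (X : Kᵒᵖ) :
    Function.Surjective (e.hom.app X) := by
  have hG := essSupp_of_isSmall hwp hmono G.obj G.property
  let H := pushout e.hom e.hom
  have hH : EssSupp H := by
    obtain ⟨T, A, hA⟩ := hG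
    refine ⟨T, A, fun X ⟨x⟩ => hA X ⟨?_⟩⟩
    exact (pushout.desc (𝟙 _) (𝟙 _) rfl : H ⟶ G.obj).app _ x
  let H' : PCompletion K := ⟨H, isSmall_of_essSupp H hH⟩
  let a : G ⟶ H' := ObjectProperty.homMk (pushout.inl e.hom e.hom)
  let b : G ⟶ H' := ObjectProperty.homMk (pushout.inr e.hom e.hom)
  have hab : a = b := by
    rw [← cancel_epi e]
    ext1
    exact pushout.condition
  have hab' : pushout.inl e.hom e.hom = pushout.inr e.hom e.hom :=
    congrArg (fun z => InducedCategory.Hom.hom z) hab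
  have : Epi e.hom := ⟨fun {Z} u w h => by
    rw [← pushout.inl_desc u w h, hab', pushout.inr_desc]⟩
  rw [← epi_iff_surjective]
  infer_instance

theorem exists_factor {K : Type u} [Category.{v} K] {F G H : Kᵒᵖ ⥤ Type v}
    (e : F ⟶ G) (e' : F ⟶ H) (he : ∀ X, Function.Surjective (e.app X))
    (h : ∀ X x y, e.app X x = e.app X y → e'.app X x = e'.app X y) :
    ∃ d : G ⟶ H, e ≫ d = e' := by
  have key : ∀ X x, e'.app X (Function.surjInv (he X) (e.app X x)) = e'.app X x :=
    fun X x => h X _ _ (Function.surjInv_eq (he X) _)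
  refine ⟨{ app := fun X => ↾(fun y => e'.app X (Function.surjInv (he X) y))
            naturality := ?_ }, ?_⟩
  · intro X Y f
    ext y
    obtain ⟨x, rfl⟩ := he X y
    have h1 := NatTrans.naturality_apply e f x
    have h2 := NatTrans.naturality_apply e' f x
    change e'.app Y (Function.surjInv (he Y) (G.map f (e.app X x))) =
      H.map f (e'.app X (Function.surjInv (he X) (e.app X x)))
    rw [key X x, ← h2, ← key Y (F.map f x)]
    exact congrArg (fun z => e'.app Y (Function.surjInv (he Y) z)) h1.symm
  · ext X x
    exact key X x

theorem le_of_kernel {K : Type u} [Category.{v} K]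
    (hwp : Wellpowered.{v} K) (hmono : ∀ {X Y : K} (f : X ⟶ Y), Mono f)
    {F : PCompletion K} {T : Type v} (A : T → K)
    (hA : ∀ X : K, Nonempty (F.obj.obj (Opposite.op X)) → ∃ t, Nonempty (X ≅ A t))
    (p q : Subobject (Opposite.op F))
    (h : ∀ t x y, p.arrow.unop.hom.app (Opposite.op (A t)) x =
        p.arrow.unop.hom.app (Opposite.op (A t)) y →
      q.arrow.unop.hom.app (Opposite.op (A t)) x =
        q.arrow.unop.hom.app (Opposite.op (A t)) y) : q ≤ p := by
  obtain ⟨d, hd⟩ := exists_factor p.arrow.unop.hom q.arrow.unop.hom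
    (surjective_of_epi hwp hmono p.arrow.unop) (by
      rintro ⟨X⟩ x y hxy
      obtain ⟨t, ⟨i⟩⟩ := hA X ⟨x⟩
      have := h t (F.obj.map i.inv.op x) (F.obj.map i.inv.op y) (by
        have h1 := NatTrans.naturality_apply p.arrow.unop.hom i.inv.op x
        have h2 := NatTrans.naturality_apply p.arrow.unop.hom i.inv.op y
        exact h1.trans ((congrArg _ hxy).trans h2.symm))
      have h1 := NatTrans.naturality_apply q.arrow.unop.hom i.inv.op x
      have h2 := NatTrans.naturality_apply q.arrow.unop.hom i.inv.op y
      have h3 := h1.symm.trans (this.trans h2)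
      have hinj : Function.Injective ((q : (PCompletion K)ᵒᵖ).unop.obj.map i.inv.op) := by
        rw [← mono_iff_injective]
        infer_instance
      exact hinj h3)
  refine Subobject.le_of_comm (Quiver.Hom.op (ObjectProperty.homMk d)) ?_
  apply Quiver.Hom.unop_inj
  ext1
  exact hd

/-- Proposition 5.2: if a wellpowered category `𝒦` has all morphisms
monic, then `𝒫𝒦` is cowellpowered. -/
theorem pCompletion_cowellpowered_of_allMono (K : Type u) [Category.{v} K]
    (hwp : Wellpowered.{v} K) (hmono : ∀ {X Y : K} (f : X ⟶ Y), Mono f) :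
    Cowellpowered.{v} (PCompletion K) := by
  intro F
  obtain ⟨T, A, hA⟩ := essSupp_of_isSmall hwp hmono F.obj F.property
  refine small_of_injective
    (β := ∀ t, F.obj.obj (Opposite.op (A t)) → F.obj.obj (Opposite.op (A t)) → Prop)
    (f := fun p t x y => p.arrow.unop.hom.app (Opposite.op (A t)) x =
        p.arrow.unop.hom.app (Opposite.op (A t)) y) ?_
  intro p q hpq
  have hk : ∀ t x y, (p.arrow.unop.hom.app (Opposite.op (A t)) x =
        p.arrow.unop.hom.app (Opposite.op (A t)) y) =
      (q.arrow.unop.hom.app (Opposite.op (A t)) x =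
        q.arrow.unop.hom.app (Opposite.op (A t)) y) :=
    fun t x y => congrFun (congrFun (congrFun hpq t) x) y
  apply le_antisymm
  · exact le_of_kernel hwp hmono A hA q p fun t x y h => (hk t x y).mpr h
  · exact le_of_kernel hwp hmono A hA p q fun t x y h => (hk t x y).mp h
end FreeCompletions
end

section
/- If a locally small category 𝒦 has a clique-like class of objects, then the free colimit completion 𝒫(𝒦ᵒᵖ) of the dual category is not cowellpowered. -/
/- Common definitions for formalizing "How nice are free completions of categories?"
   by Adámek and Rosický. -/

open CategoryTheory CategoryTheory.Limits

universe w w₁ w₂ v₁ u₁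

namespace FreeCompletions

universe v u

/-- The Rees-type setoid collapsing all morphisms factoring through `a` or `b`. -/
def reesSetoid {C : Type u} [Category.{v} C] {B X : C} (a b : B ⟶ X) (Z : C) :
    Setoid (Z ⟶ X) where
  r s t := s = t ∨ ((∃ h : Z ⟶ B, s = h ≫ a ∨ s = h ≫ b) ∧ (∃ h : Z ⟶ B, t = h ≫ a ∨ t = h ≫ b))
  iseqv := ⟨fun _ => Or.inl rfl,
    fun {s t} h => by
      rcases h with h | ⟨h1, h2⟩
      · exact Or.inl h.symm
      · exact Or.inr ⟨h2, h1⟩,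
    fun {s t r} h h' => by
      rcases h with rfl | ⟨h1, h2⟩
      · exact h'
      · rcases h' with rfl | ⟨h3, h4⟩
        · exact Or.inr ⟨h1, h2⟩
        · exact Or.inr ⟨h1, h4⟩⟩

theorem reesSetoid_comp {C : Type u} [Category.{v} C] {B X : C} (a b : B ⟶ X) {Z W : C}
    (k : W ⟶ Z) {s t : Z ⟶ X} (h : (reesSetoid a b Z).r s t) :
    (reesSetoid a b W).r (k ≫ s) (k ≫ t) := by
  rcases h with rfl | ⟨⟨h1, h2⟩, ⟨h3, h4⟩⟩
  · exact Or.inl rfl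
  · refine Or.inr ⟨⟨k ≫ h1, ?_⟩, ⟨k ≫ h3, ?_⟩⟩
    · rcases h2 with rfl | rfl
      · left; simp
      · right; simp
    · rcases h4 with rfl | rfl
      · left; simp
      · right; simp

/-- The Rees-type quotient of a representable. -/
def reesFunctor {C : Type u} [Category.{v} C] {B X : C} (a b : B ⟶ X) : Cᵒᵖ ⥤ Type v where
  obj Z := Quotient (reesSetoid a b Z.unop)
  map k := TypeCat.ofHom (Quotient.map' (fun s => k.unop ≫ s)
    (fun _ _ h => reesSetoid_comp a b k.unop h))
  map_id Z := by
    ext x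
    induction x using Quotient.inductionOn
    simp
  map_comp k l := by
    ext x
    induction x using Quotient.inductionOn
    simp

/-- The quotient map. -/
def reesMap {C : Type u} [Category.{v} C] {B X : C} (a b : B ⟶ X) :
    yoneda.obj X ⟶ reesFunctor a b where
  app Z := TypeCat.ofHom (fun s => Quotient.mk (reesSetoid a b Z.unop) s)
  naturality _ _ _ := rfl

theorem reesMap_eq {C : Type u} [Category.{v} C] {B X : C} (a b : B ⟶ X) :
    yoneda.map a ≫ reesMap a b = yoneda.map b ≫ reesMap a b := by
  ext Z s
  exact Quotient.sound (s := reesSetoid a b Z.unop)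
    (Or.inr ⟨⟨s, Or.inl rfl⟩, ⟨s, Or.inr rfl⟩⟩)

theorem factor_of_coeq {C : Type u} [Category.{v} C] {B X B' : C} (a b : B ⟶ X) (f g : B' ⟶ X)
    (hfg : f ≠ g)
    (h : yoneda.map f ≫ coequalizer.π (yoneda.map a) (yoneda.map b) =
      yoneda.map g ≫ coequalizer.π (yoneda.map a) (yoneda.map b)) :
    ∃ k : B' ⟶ B, f = k ≫ a ∨ f = k ≫ b := by
  have h2 : yoneda.map f ≫ reesMap a b = yoneda.map g ≫ reesMap a b := by
    rw [← coequalizer.π_desc _ (reesMap_eq a b), ← Category.assoc, h, Category.assoc]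
  have h3 := ConcreteCategory.congr_hom (NatTrans.congr_app h2 (Opposite.op B')) (𝟙 B')
  have h4 : Quotient.mk (reesSetoid a b B') (𝟙 B' ≫ f) =
    Quotient.mk (reesSetoid a b B') (𝟙 B' ≫ g) := h3
  rw [Category.id_comp, Category.id_comp] at h4
  rcases Quotient.exact h4 with h5 | h5
  · exact absurd h5 hfg
  · exact h5.1

theorem isSmallPresheaf_coeq {C : Type u} [Category.{v} C] {B X : C} (a b : B ⟶ X) :
    IsSmallPresheaf.{v} (coequalizer (yoneda.map a) (yoneda.map b)) := by
  let E := (ULiftHomULiftCategory.equiv.{v, v} WalkingParallelPair).symm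
  refine ⟨ULiftHom.{v} (ULift.{v} WalkingParallelPair), inferInstance,
    E.functor ⋙ parallelPair a b,
    (colimit.cocone (parallelPair a b ⋙ yoneda)).whisker E.functor,
    ⟨(colimit.isColimit (parallelPair a b ⋙ yoneda)).whiskerEquivalence E⟩,
    ⟨HasColimit.isoOfNatIso (diagramIsoParallelPair _)⟩⟩

theorem isSmallPresheaf_yoneda {C : Type u} [Category.{v} C] (X : C) :
    IsSmallPresheaf.{v} (yoneda.obj X) := by
  refine ⟨Discrete PUnit.{v+1}, inferInstance, (Functor.const _).obj X,
    { pt := yoneda.obj X, ι := { app := fun _ => 𝟙 _ } },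
    ⟨{ desc := fun s => s.ι.app ⟨⟨⟩⟩ }⟩, ⟨Iso.refl _⟩⟩

/-- The quotient object of `𝒫𝒦`. -/
noncomputable def quotMap {C : Type u} [Category.{v} C] {B X : C} (a b : B ⟶ X) :
    (⟨yoneda.obj X, isSmallPresheaf_yoneda X⟩ : PCompletion C) ⟶
      ⟨coequalizer (yoneda.map a) (yoneda.map b), isSmallPresheaf_coeq a b⟩ :=
  ObjectProperty.homMk (coequalizer.π (yoneda.map a) (yoneda.map b))

instance {C : Type u} [Category.{v} C] {B X : C} (a b : B ⟶ X) : Epi (quotMap a b) where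
  left_cancellation s t h := by
    apply ObjectProperty.hom_ext
    have h' := congrArg (fun x => x.hom) h
    exact (cancel_epi (coequalizer.π (yoneda.map a) (yoneda.map b))).1 h'

theorem factor_of_mk_le {C : Type u} [Category.{v} C] {B X B' : C} (a b : B ⟶ X) (f g : B' ⟶ X)
    (hfg : f ≠ g) (h : Subobject.mk (quotMap a b).op = Subobject.mk (quotMap f g).op) :
    ∃ k : B' ⟶ B, f = k ≫ a ∨ f = k ≫ b := by
  apply factor_of_coeq a b f g hfg
  have h1 := Subobject.ofMkLEMk_comp h.le
  have h2 : quotMap f g ≫ (Subobject.ofMkLEMk _ _ h.le).unop = quotMap a b :=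
    congrArg Quiver.Hom.unop h1
  have h3 : coequalizer.π (yoneda.map f) (yoneda.map g) ≫
    (Subobject.ofMkLEMk _ _ h.le).unop.hom = coequalizer.π (yoneda.map a) (yoneda.map b) :=
    congrArg (fun x => x.hom) h2
  rw [← h3, ← Category.assoc, coequalizer.condition, Category.assoc]

/-- Proposition 5.7: if a category `𝒦` has a clique-like class of
objects, then `𝒫(𝒦ᵒᵖ)` is not cowellpowered. -/
theorem pCompletion_op_not_cowellpowered (K : Type u) [Category.{v} K]
    (h : HasCliqueLikeClass K) :
    ¬ Cowellpowered.{v} (PCompletion Kᵒᵖ) := by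
  obtain ⟨A, R, hR, hA, hC⟩ := h
  choose f g hfg hf hg using hA
  intro hco
  have hsm := hco ⟨yoneda.obj (Opposite.op (A 0)), isSmallPresheaf_yoneda _⟩
  let q : Ordinal.{v} → Subobject (Opposite.op
      (⟨yoneda.obj (Opposite.op (A 0)), isSmallPresheaf_yoneda _⟩ : PCompletion Kᵒᵖ)) :=
    fun k => Subobject.mk (quotMap (f (Order.succ k)).op (g (Order.succ k)).op).op
  have key : ∀ i k, q i = q k → ∃ m : A (Order.succ i) ⟶ A (Order.succ k), R m := by
    intro i k hik
    obtain ⟨m, hm⟩ := factor_of_mk_le _ _ _ _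
      (fun e => hfg (Order.succ k) (Quiver.Hom.op_inj e)) hik
    refine ⟨m.unop, ?_⟩
    rcases hm with hm | hm
    · have e : f (Order.succ k) = f (Order.succ i) ≫ m.unop := congrArg Quiver.Hom.unop hm
      exact hR _ _ (e ▸ hf _)
    · have e : f (Order.succ k) = g (Order.succ i) ≫ m.unop := congrArg Quiver.Hom.unop hm
      exact hR _ _ (e ▸ hf _)
  have lt_absurd : ∀ i k, i < k → q i ≠ q k := by
    intro i k hik he
    have hs : Order.succ i < Order.succ k := Order.succ_lt_succ hik
    have hp : 0 < Order.succ i := (zero_le (a := i)).trans_lt (Order.lt_succ i)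
    rcases hC with hC | hC
    · obtain ⟨m, hm⟩ := key k i he.symm
      exact hC _ _ hp hs m hm
    · obtain ⟨m, hm⟩ := key i k he
      exact hC _ _ hp hs m hm
  have hinj : Function.Injective q := by
    intro i k he
    rcases lt_trichotomy i k with h | h | h
    · exact absurd he (lt_absurd _ _ h)
    · exact h
    · exact absurd he.symm (lt_absurd _ _ h)
  exact not_small_ordinal.{v, v} (small_of_injective hinj)
end FreeCompletions
end
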